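/- Let M₁ and M₂ be closed oriented n-dimensional manifolds with n ≥ 4 such that π₂(M₁) = π₂(M₂) = 0, and suppose there exist non-trivial homology classes v_j ∈ H₂(M_j; ℚ) with H₂(c_{M_j})(v_j) ≠ 0 for j = 1, 2, where c_{M_j} : M_j → Bπ₁(M_j) is the classifying map. Then the homology class v = (v₁, v₂) ∈ H₂(M₁ # M₂; ℚ) = H₂(M₁; ℚ) ⊕ H₂(M₂; ℚ) is atoroidal. -/

import Mathlib

/-!
Common definitions: rational singular (co)homology, homotopy groups and asphericity,
classifying maps, closed oriented manifolds, connected sums, wedges, topological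
complexity, sectional category weights, and (a)toroidal classes.
-/

open CategoryTheory unitInterval Topology

noncomputable section

/-- The singular chain complex with rational coefficients. -/
def singularChainComplex : TopCat.{0} ⥤ ChainComplex (ModuleCat.{0} ℚ) ℕ :=
  TopCat.toSSet ⋙ ((SimplicialObject.whiskering _ _).obj (ModuleCat.free ℚ)) ⋙
    AlgebraicTopology.alternatingFaceMapComplex (ModuleCat ℚ)

/-- The `k`-th singular homology functor with rational coefficients. -/
def singularHomologyFunctor (k : ℕ) : TopCat.{0} ⥤ ModuleCat.{0} ℚ :=
  singularChainComplex ⋙ HomologicalComplex.homologyFunctor (ModuleCat ℚ) (ComplexShape.down ℕ) k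

/-- `H k X` is the `k`-th rational singular homology group `H_k(X; ℚ)`. -/
abbrev H (k : ℕ) (X : Type) [TopologicalSpace X] : Type :=
  (singularHomologyFunctor k).obj (TopCat.of X)

/-- The map `H_k(f; ℚ)` induced on rational singular homology by a continuous map `f`. -/
def Hmap (k : ℕ) {X Y : Type} [TopologicalSpace X] [TopologicalSpace Y] (f : C(X, Y)) :
    H k X →ₗ[ℚ] H k Y :=
  ((singularHomologyFunctor k).map (TopCat.ofHom f : TopCat.of X ⟶ TopCat.of Y)).hom

/-- `Hco k X` is the `k`-th rational singular cohomology group `H^k(X; ℚ)`; over the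
field `ℚ`, universal coefficients identify it naturally with the dual of homology. -/
abbrev Hco (k : ℕ) (X : Type) [TopologicalSpace X] : Type :=
  Module.Dual ℚ (H k X)

/-- The map `H^k(f; ℚ)` induced on rational singular cohomology (the Kronecker-dual
of the map induced on homology). -/
def Hcomap (k : ℕ) {X Y : Type} [TopologicalSpace X] [TopologicalSpace Y] (f : C(X, Y)) :
    Hco k Y →ₗ[ℚ] Hco k X :=
  (Hmap k f).dualMap

/-- Transport of a cohomology class along an equality of degrees. -/
def coCast {X : Type} [TopologicalSpace X] {p q : ℕ} (h : p = q) :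
    Hco p X →ₗ[ℚ] Hco q X := by
  subst h; exact LinearMap.id

/-- A non-zero element spanning a rational vector space (necessarily one-dimensional);
this characterises fundamental classes in the top (co)homology of closed connected
oriented manifolds with rational coefficients. -/
def IsGenerator {W : Type} [AddCommGroup W] [Module ℚ W] (w : W) : Prop :=
  w ≠ 0 ∧ ∀ v : W, ∃ c : ℚ, v = c • w

/-- `π₂(X) = 0`. -/
def Pi2Trivial (X : Type) [TopologicalSpace X] : Prop :=
  ∀ x : X, Subsingleton (HomotopyGroup (Fin 2) X x)

/-- A space is aspherical iff all its homotopy groups in degrees `≥ 2` vanish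
(for manifolds this is equivalent to contractibility of the universal cover). -/
def Aspherical (X : Type) [TopologicalSpace X] : Prop :=
  ∀ k : ℕ, 2 ≤ k → ∀ x : X, Subsingleton (HomotopyGroup (Fin k) X x)

/-- A continuous map, regarded as a morphism in `TopCat`. -/
def toTopHom {X Y : Type} [TopologicalSpace X] [TopologicalSpace Y] (f : C(X, Y)) :
    TopCat.of X ⟶ TopCat.of Y := TopCat.ofHom f

/-- The homomorphism induced by a continuous map on fundamental groups. -/
def π₁map {X Y : Type} [TopologicalSpace X] [TopologicalSpace Y] (f : C(X, Y)) (x : X) :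
    FundamentalGroup X x →* FundamentalGroup Y (f x) :=
  Functor.mapEnd (X := FundamentalGroupoid.mk x)
    (show FundamentalGroupoid X ⥤ FundamentalGroupoid Y from
      FundamentalGroupoid.fundamentalGroupoidFunctor.map (toTopHom f))

/-- `B` is a model for an Eilenberg–MacLane space `K(G, 1)`:  it is path-connected and
all its higher homotopy groups vanish. -/
def IsAsphericalSpace (B : Type) [TopologicalSpace B] : Prop :=
  PathConnectedSpace B ∧ Aspherical B

/-- `c : M → B` is a classifying map for `M`, i.e. `B` is a model for `Bπ₁(M)`
(path-connected with vanishing higher homotopy groups) and `c` induces an isomorphism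
on fundamental groups. -/
def IsClassifyingMap {M B : Type} [TopologicalSpace M] [TopologicalSpace B]
    (c : C(M, B)) : Prop :=
  IsAsphericalSpace B ∧ ∀ x : M, Function.Bijective (π₁map c x)

/-- Every point has a neighbourhood homeomorphic to `ℝⁿ`. -/
def IsLocallyEuclidean (n : ℕ) (M : Type) [TopologicalSpace M] : Prop :=
  ∀ x : M, ∃ U : Set M, x ∈ U ∧ IsOpen U ∧ Nonempty (U ≃ₜ EuclideanSpace ℝ (Fin n))

/-- A closed connected oriented topological `n`-manifold.  (For a closed connected
`n`-manifold, orientability is equivalent to `H_n(M; ℚ) ≠ 0`.) -/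
def IsClosedOrientedManifold (n : ℕ) (M : Type) [TopologicalSpace M] : Prop :=
  CompactSpace M ∧ T2Space M ∧ SecondCountableTopology M ∧ ConnectedSpace M ∧
    IsLocallyEuclidean n M ∧ Nontrivial (H n M)

/-- Data exhibiting `N` as a connected sum `M₁ # M₂` of `n`-manifolds:  `N` is covered by
two closed pieces `C₁`, `C₂`, homeomorphic to `M₁` resp. `M₂` with an embedded open ball
removed, which overlap exactly along the boundary spheres.  (Gluing along any
homeomorphism of the sphere yields a space homeomorphic to the connected sum.) -/
structure ConnectedSumData (n : ℕ) (N M₁ M₂ : Type) [TopologicalSpace N]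
    [TopologicalSpace M₁] [TopologicalSpace M₂] where
  φ₁ : EuclideanSpace ℝ (Fin n) → M₁
  φ₂ : EuclideanSpace ℝ (Fin n) → M₂
  emb₁ : IsOpenEmbedding φ₁
  emb₂ : IsOpenEmbedding φ₂
  C₁ : Set N
  C₂ : Set N
  closed₁ : IsClosed C₁
  closed₂ : IsClosed C₂
  cover : C₁ ∪ C₂ = Set.univ
  h₁ : C₁ ≃ₜ ((φ₁ '' Metric.ball 0 1)ᶜ : Set M₁)
  h₂ : C₂ ≃ₜ ((φ₂ '' Metric.ball 0 1)ᶜ : Set M₂)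
  inter₁ : ∀ x : C₁, (x : N) ∈ C₂ ↔ ((h₁ x : M₁) ∈ φ₁ '' Metric.sphere 0 1)
  inter₂ : ∀ x : C₂, (x : N) ∈ C₁ ↔ ((h₂ x : M₂) ∈ φ₂ '' Metric.sphere 0 1)

/-- `N` is a connected sum of `M₁` and `M₂` (as `n`-manifolds). -/
def IsConnectedSum (n : ℕ) (N M₁ M₂ : Type) [TopologicalSpace N]
    [TopologicalSpace M₁] [TopologicalSpace M₂] : Prop :=
  Nonempty (ConnectedSumData n N M₁ M₂)

/-- The degree-one pinch map `N = M₁ # M₂ → M₁`:  it restricts to the canonical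
identification on the `M₁`-piece and sends the `M₂`-piece into the closed ball. -/
def ConnectedSumData.IsPinchFst {n : ℕ} {N M₁ M₂ : Type} [TopologicalSpace N]
    [TopologicalSpace M₁] [TopologicalSpace M₂] (D : ConnectedSumData n N M₁ M₂)
    (p : C(N, M₁)) : Prop :=
  (∀ x : D.C₁, p (x : N) = (D.h₁ x : M₁)) ∧
    ∀ x : D.C₂, p (x : N) ∈ D.φ₁ '' Metric.closedBall 0 1

/-- The degree-one pinch map `N = M₁ # M₂ → M₂`. -/
def ConnectedSumData.IsPinchSnd {n : ℕ} {N M₁ M₂ : Type} [TopologicalSpace N]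
    [TopologicalSpace M₁] [TopologicalSpace M₂] (D : ConnectedSumData n N M₁ M₂)
    (p : C(N, M₂)) : Prop :=
  (∀ x : D.C₂, p (x : N) = (D.h₂ x : M₂)) ∧
    ∀ x : D.C₁, p (x : N) ∈ D.φ₂ '' Metric.closedBall 0 1

/-- `N` is an iterated connected sum `M 0 # M 1 # ⋯ # M (m-1)` of `n`-manifolds. -/
def IsIteratedConnectedSum (n : ℕ) (N : Type) [TopologicalSpace N] :
    (m : ℕ) → (Fin m → TopCat.{0}) → Prop
  | 0, _ => False
  | 1, M => Nonempty (N ≃ₜ (M 0))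
  | (m + 2), M =>
      ∃ P : TopCat.{0}, IsIteratedConnectedSum n P (m + 1) (fun i => M i.castSucc) ∧
        IsConnectedSum n N P (M (Fin.last (m + 1)))

/-- `W` is the wedge (one-point union) of the pointed spaces `(M₁, x₁)` and `(M₂, x₂)`. -/
def IsWedge (W M₁ M₂ : Type) [TopologicalSpace W] [TopologicalSpace M₁]
    [TopologicalSpace M₂] (x₁ : M₁) (x₂ : M₂) : Prop :=
  ∃ (j₁ : C(M₁, W)) (j₂ : C(M₂, W)), IsClosedEmbedding j₁ ∧ IsClosedEmbedding j₂ ∧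
    Set.range j₁ ∪ Set.range j₂ = Set.univ ∧
    Set.range j₁ ∩ Set.range j₂ = {j₁ x₁} ∧ j₁ x₁ = j₂ x₂

/-- `X × X` admits a cover by `m` open sets over each of which there is a continuous
motion planning rule (a continuous local section of the free path fibration). -/
def TCCoverable (X : Type) [TopologicalSpace X] (m : ℕ) : Prop :=
  ∃ U : Fin m → Set (X × X), (∀ i, IsOpen (U i)) ∧ (⋃ i, U i) = Set.univ ∧
    ∀ i, ∃ s : C(U i, C(I, X)),
      ∀ p : U i, (s p) 0 = (p : X × X).1 ∧ (s p) 1 = (p : X × X).2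

/-- The (unreduced) topological complexity of `X`:  the smallest number of open sets in a
cover of `X × X` admitting continuous motion planning rules (`⊤` if there is none). -/
def topologicalComplexity (X : Type) [TopologicalSpace X] : ℕ∞ :=
  sInf {c : ℕ∞ | ∃ m : ℕ, c = m ∧ TCCoverable X m}

/-- The free path fibration `X^{[0,1]} → X × X`, `γ ↦ (γ(0), γ(1))`. -/
def pathFibration (X : Type) [TopologicalSpace X] : C(C(I, X), X × X) :=
  ⟨fun γ => (γ 0, γ 1), (continuous_eval_const 0).prodMk (continuous_eval_const 1)⟩

/-- The Schwarz genus (sectional category) of the pullback of `p` along `f` is at most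
`k`:  `Y` is covered by `k` open sets over each of which `f` lifts continuously
through `p`. -/
def GenusPullbackLE {E B : Type} [TopologicalSpace E] [TopologicalSpace B] (p : C(E, B))
    {Y : Type} [TopologicalSpace Y] (f : C(Y, B)) (k : ℕ) : Prop :=
  ∃ U : Fin k → Set Y, (∀ i, IsOpen (U i)) ∧ (⋃ i, U i) = Set.univ ∧
    ∀ i, ∃ s : C(U i, E), ∀ y : U i, p (s y) = f (y : Y)

/-- The sectional category weight of a cohomology class `u` on the base of `p`:  the
supremum of those `m` such that `u` pulls back to zero along every map `f` for which
the pullback of `p` along `f` has Schwarz genus at most `m`. -/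
def secatWeight {E B : Type} [TopologicalSpace E] [TopologicalSpace B] (p : C(E, B))
    {k : ℕ} (u : Hco k B) : ℕ∞ :=
  sSup {w : ℕ∞ | ∃ m : ℕ, w = m ∧ ∀ (Y : Type) [TopologicalSpace Y] (f : C(Y, B)),
    GenusPullbackLE p f m → Hcomap k f u = 0}

/-- The topological complexity weight:  sectional category weight with respect to the
free path fibration. -/
def tcWeight {X : Type} [TopologicalSpace X] {k : ℕ} (u : Hco k (X × X)) : ℕ∞ :=
  secatWeight (pathFibration X) u

/-- The `n`-dimensional sphere. -/
abbrev unitSphere (n : ℕ) : Type :=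
  ↥(Metric.sphere (0 : EuclideanSpace ℝ (Fin (n + 1))) 1)

/-- The 2-torus `T² = S¹ × S¹`. -/
abbrev Torus2 : Type := unitSphere 1 × unitSphere 1

/-- A degree-two rational homology class `v` is toroidal (relative to a fundamental class
`ωT` of the torus) if some map from the torus realises a non-zero multiple of `v`. -/
def IsToroidal {X : Type} [TopologicalSpace X] (ωT : H 2 Torus2) (v : H 2 X) : Prop :=
  ∃ (f : C(Torus2, X)) (α : ℚ), α ≠ 0 ∧ Hmap 2 f ωT = α • v

/-- A non-zero degree-two rational homology class is atoroidal if it is not toroidal. -/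
def IsAtoroidal {X : Type} [TopologicalSpace X] (ωT : H 2 Torus2) (v : H 2 X) : Prop :=
  v ≠ 0 ∧ ¬ IsToroidal ωT v

/-- A degree-two rational cohomology class `u` is toroidal if it pulls back non-trivially
under some map from the torus. -/
def IsCoToroidal {X : Type} [TopologicalSpace X] (u : Hco 2 X) : Prop :=
  ∃ f : C(Torus2, X), Hcomap 2 f u ≠ 0

/-- A non-zero degree-two rational cohomology class is atoroidal if it pulls back to zero
under every map from the torus. -/
def IsCoAtoroidal {X : Type} [TopologicalSpace X] (u : Hco 2 X) : Prop :=
  u ≠ 0 ∧ ∀ f : C(Torus2, X), Hcomap 2 f u = 0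

theorem Hmap_id (k : ℕ) (X : Type) [TopologicalSpace X] :
    Hmap k (ContinuousMap.id X) = LinearMap.id := by
  have := (singularHomologyFunctor k).map_id (TopCat.of X)
  exact congrArg ModuleCat.Hom.hom this

theorem Hmap_comp (k : ℕ) {X Y Z : Type} [TopologicalSpace X] [TopologicalSpace Y]
    [TopologicalSpace Z] (g : C(Y, Z)) (f : C(X, Y)) :
    Hmap k (g.comp f) = (Hmap k g).comp (Hmap k f) := by
  have := (singularHomologyFunctor k).map_comp (TopCat.ofHom f) (TopCat.ofHom g)
  exact congrArg ModuleCat.Hom.hom this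

theorem Hmap_eq_of_homotopic (k : ℕ) {X Y : Type} [TopologicalSpace X] [TopologicalSpace Y]
    {f g : C(X, Y)} (h : f.Homotopic g) : Hmap k f = Hmap k g := by
  obtain ⟨h⟩ := h
  have F : TopCat.Homotopy (TopCat.ofHom f) (TopCat.ofHom g) := h
  have := (F.toSSet.toSimplicialObjectHomotopy.whiskerRight (ModuleCat.free ℚ)).map_homology_eq k
  exact congrArg ModuleCat.Hom.hom this

theorem subsingleton_H_punit (k : ℕ) (hk : k ≠ 0) : Subsingleton (H k PUnit) := by
  have e : singularChainComplex.obj (TopCat.of PUnit) ≅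
      ChainComplex.alternatingConst.obj ((ModuleCat.free ℚ).obj PUnit) :=
    (AlgebraicTopology.alternatingFaceMapComplex _).mapIso
    (((SimplicialObject.whiskering _ _).obj _).mapIso
    (TopCat.toSSetIsoConst (TopCat.of PUnit)) ≪≫ Functor.constComp _ _ _) ≪≫
    AlgebraicTopology.alternatingFaceMapComplexConst.app _
  have h : (singularChainComplex.obj (TopCat.of PUnit)).ExactAt k :=
    .of_iso (ChainComplex.alternatingConst_exactAt _ _ hk) e.symm
  exact ModuleCat.subsingleton_of_isZero h.isZero_homology

theorem subsingleton_H_of_isGenerator_prod {k : ℕ} (hk : k ≠ 0) {S : Type} [TopologicalSpace S]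
    (s₀ : S) {ω : H k (S × S)} (hω : IsGenerator ω) : Subsingleton (H k S) := by
  obtain ⟨hω0, hgen⟩ := hω
  let i₁ : C(S, S × S) := ⟨fun z => (z, s₀), by fun_prop⟩
  let i₂ : C(S, S × S) := ⟨fun z => (s₀, z), by fun_prop⟩
  let q₁ : C(S × S, S) := ContinuousMap.fst
  let q₂ : C(S × S, S) := ContinuousMap.snd
  let sw : C(S × S, S × S) := ⟨Prod.swap, continuous_swap⟩
  obtain ⟨d, hd⟩ := hgen (Hmap k (i₁.comp q₁) ω)
  obtain ⟨d', hd'⟩ := hgen (Hmap k (i₂.comp q₂) ω)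
  obtain ⟨e, he⟩ := hgen (Hmap k sw ω)
  have hswsw : Hmap k sw (Hmap k sw ω) = ω := by
    have h : sw.comp sw = ContinuousMap.id _ := rfl
    rw [← LinearMap.comp_apply, ← Hmap_comp, h, Hmap_id, LinearMap.id_apply]
  have he0 : e ≠ 0 := by
    rintro rfl
    rw [he, zero_smul, map_zero] at hswsw
    exact hω0 hswsw.symm
  have hdd : d' = d := by
    have h : (i₂.comp q₂).comp sw = sw.comp (i₁.comp q₁) := rfl
    have h2 := congrArg (fun f => Hmap k f ω) h
    simp only [Hmap_comp k (i₂.comp q₂) sw, Hmap_comp k sw (i₁.comp q₁), LinearMap.comp_apply,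
      he, hd, hd', map_smul, smul_smul] at h2
    have h3 := smul_left_injective ℚ hω0 h2
    exact mul_left_cancel₀ he0 (by simpa [mul_comm] using h3)
  have hd0 : d = 0 := by
    let t : C(S × S, PUnit) := ⟨fun _ => PUnit.unit, continuous_const⟩
    let u : C(PUnit, S × S) := ⟨fun _ => (s₀, s₀), continuous_const⟩
    have h : (i₂.comp q₂).comp (i₁.comp q₁) = u.comp t := rfl
    have := subsingleton_H_punit k hk
    have h2 := congrArg (fun f => Hmap k f ω) h
    have h0 : Hmap k (u.comp t) ω = 0 := by
      rw [Hmap_comp, LinearMap.comp_apply, Subsingleton.elim (Hmap k t ω) 0, map_zero]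
    simp only [Hmap_comp k (i₂.comp q₂) (i₁.comp q₁), h0, LinearMap.comp_apply,
      hd, hd', map_smul, smul_smul] at h2
    rcases smul_eq_zero.1 h2 with h3 | h3
    · rw [hdd] at h3
      exact mul_self_eq_zero.1 h3
    · exact absurd h3 hω0
  refine subsingleton_of_forall_eq 0 fun x => ?_
  obtain ⟨c, hc⟩ := hgen (Hmap k i₁ x)
  have h : q₁.comp ((i₁.comp q₁).comp i₁) = ContinuousMap.id S := rfl
  have h2 := congrArg (fun f => Hmap k f x) h
  simp only [Hmap_comp k q₁ ((i₁.comp q₁).comp i₁), Hmap_comp k (i₁.comp q₁) i₁,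
    LinearMap.comp_apply, hc, map_smul, hd, hd0, zero_smul, smul_zero, map_zero, Hmap_id,
    LinearMap.id_apply] at h2
  exact h2.symm

theorem FreeMonoid.exists_pow_eq_pow_of_commute {α : Type*} (u v : FreeMonoid α)
    (h : u * v = v * u) : ∃ (g : FreeMonoid α) (m k : ℕ), u = g ^ m ∧ v = g ^ k := by
  induction hn : u.length + v.length using Nat.strong_induction_on generalizing u v with
  | _ n ih =>
  wlog huv : u.length ≤ v.length generalizing u v
  · obtain ⟨g, m, k, hv, hu⟩ := this v u h.symm (by omega) (by omega)
    exact ⟨g, k, m, hu, hv⟩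
  by_cases hu : u = 1
  · exact ⟨v, 0, 1, by simp [hu], by simp⟩
  have hpre : u.toList <+: v.toList := by
    have h' : u.toList ++ v.toList = v.toList ++ u.toList := congrArg FreeMonoid.toList h
    exact List.prefix_of_prefix_length_le (List.prefix_append _ v.toList)
      (h' ▸ List.prefix_append _ _) huv
  obtain ⟨w, hw⟩ := hpre
  obtain rfl : u * FreeMonoid.ofList w = v := congrArg FreeMonoid.ofList hw
  have hpos : 0 < u.length := Nat.pos_of_ne_zero fun h0 => hu (FreeMonoid.length_eq_zero.1 h0)
  rw [FreeMonoid.length_mul] at hn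
  obtain ⟨g, m, k, hm, hk⟩ := ih (u.length + (FreeMonoid.ofList w).length) (by omega) u
    (FreeMonoid.ofList w) (by simpa [mul_assoc] using h) rfl
  exact ⟨g, m, m + k, hm, by rw [hk, pow_add, ← hm]⟩

namespace Monoid.CoprodI

variable {ι : Type*} {G : ι → Type*} [∀ i, Group (G i)]

theorem Word.prod_injective : Function.Injective (Word.prod : Word G → CoprodI G) := by
  classical exact Word.equiv.symm.injective

theorem Word.exists_prod_eq (x : CoprodI G) : ∃ w : Word G, w.prod = x := by
  classical exact Word.equiv.symm.surjective x

theorem Word.eq_one_or_exists_neWord (w : Word G) :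
    w.prod = 1 ∨ ∃ (i j : ι) (u : NeWord G i j), u.toWord = w := by
  by_cases h : w = Word.empty
  · left; rw [h]; rfl
  · right; exact NeWord.of_word w h

theorem NeWord.toList_eq_of_prod_eq {i j k l : ι} {u : NeWord G i j} {v : NeWord G k l}
    (h : u.prod = v.prod) : u.toList = v.toList :=
  congrArg Word.toList (Word.prod_injective h)

theorem NeWord.length_pos {i j : ι} (u : NeWord G i j) : 0 < u.toList.length :=
  List.length_pos_of_ne_nil u.toList_ne_nil

/-- A contiguous part of a reduced word. -/
def Word.infix (w : Word G) (t : List (Σ i, G i)) (h : t <:+: w.toList) : Word G where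
  toList := t
  ne_one l hl := w.ne_one l (h.subset hl)
  chain_ne := w.chain_ne.infix h

/-- Remove the letters of `G i` from both ends of a reduced word. -/
theorem Word.exists_strip (i : ι) (w : Word G) : ∃ (p q : G i) (x : CoprodI G),
    w.prod = of p * x * of q ∧
      (x = 1 ∨ ∃ (k l : ι) (u : NeWord G k l), k ≠ i ∧ l ≠ i ∧ u.prod = x) := by
  induction hn : w.toList.length using Nat.strong_induction_on generalizing w with
  | _ n ih =>
  rcases w.eq_one_or_exists_neWord with h1 | ⟨k, l, u, rfl⟩
  · exact ⟨1, 1, 1, by simp [h1], Or.inl rfl⟩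
  by_cases hk : k = i
  · subst hk
    obtain ⟨t, ht⟩ : ∃ t, u.toWord.toList = ⟨k, u.head⟩ :: t :=
      List.head?_eq_some_iff.1 u.toList_head?
    obtain ⟨p, q, x, hx, hx'⟩ := ih t.length (by simp [← hn, ht])
      (u.toWord.infix t (ht ▸ (List.suffix_cons _ _).isInfix)) rfl
    refine ⟨u.head * p, q, x, ?_, hx'⟩
    simp only [map_mul, mul_assoc]
    rw [← mul_assoc (of p), ← hx]
    simp [Word.prod, ht, Word.infix]
  by_cases hl : l = i
  · subst hl
    obtain ⟨t, ht⟩ : ∃ t, u.toWord.toList = t ++ [⟨l, u.last⟩] :=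
      List.getLast?_eq_some_iff.1 u.toList_getLast?
    obtain ⟨p, q, x, hx, hx'⟩ := ih t.length (by simp [← hn, ht])
      (u.toWord.infix t (ht ▸ (List.prefix_append _ _).isInfix)) rfl
    refine ⟨p, q * u.last, x, ?_, hx'⟩
    rw [map_mul, ← mul_assoc, ← hx]
    simp [Word.prod, ht, Word.infix]
  exact ⟨1, 1, u.prod, by simp [NeWord.prod], Or.inr ⟨k, l, u, hk, hl, rfl⟩⟩

/-- Every element is conjugate to an element of a factor or to a cyclically reduced word. -/
theorem exists_conj_cyclically_reduced [Nonempty ι] (x : CoprodI G) : ∃ c y : CoprodI G,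
    x = c * y * c⁻¹ ∧ ((∃ (i : ι) (g : G i), y = of g) ∨
      ∃ (i j : ι) (u : NeWord G i j), i ≠ j ∧ u.prod = y) := by
  obtain ⟨w, rfl⟩ := Word.exists_prod_eq x
  induction hn : w.toList.length using Nat.strong_induction_on generalizing w with
  | _ n ih =>
  rcases w.eq_one_or_exists_neWord with h1 | ⟨i, j, u, rfl⟩
  · exact ⟨1, 1, by simp [h1], Or.inl ⟨Classical.arbitrary ι, 1, by simp⟩⟩
  by_cases hij : i = j
  · subst hij
    obtain ⟨t, ht⟩ : ∃ t, u.toWord.toList = ⟨i, u.head⟩ :: t :=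
      List.head?_eq_some_iff.1 u.toList_head?
    have hprod : u.toWord.prod = of u.head * (t.map fun l => of l.snd).prod := by
      simp [Word.prod, ht]
    rcases List.eq_nil_or_concat t with rfl | ⟨s, ⟨k, g⟩, rfl⟩
    · exact ⟨1, u.toWord.prod, by simp, Or.inl ⟨i, u.head, by simp [hprod]⟩⟩
    have hlast := u.toList_getLast?
    rw [show u.toList = _ from ht] at hlast
    simp only [List.concat_eq_append] at hlast hprod ht
    rw [← List.cons_append, List.getLast?_append] at hlast
    simp only [List.getLast?_singleton, Option.some_or, Option.some.injEq] at hlast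
    obtain rfl : k = i := congrArg Sigma.fst hlast
    have hconj : u.toWord.prod = of u.head *
        ((s.map fun l => of l.snd).prod * of (g * u.head)) * (of u.head)⁻¹ := by
      simp [hprod, mul_assoc]
    by_cases hg : g * u.head = 1
    · obtain ⟨c, y, hy, hy'⟩ := ih s.length (by simp [← hn, ht]) (u.toWord.infix s
        (ht ▸ ⟨[⟨k, u.head⟩], [⟨k, g⟩], by simp⟩)) rfl
      refine ⟨of u.head * c, y, ?_, hy'⟩
      rw [hconj, hg, map_one, mul_one]
      have : (s.map fun l => of l.snd).prod = c * y * c⁻¹ := hy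
      rw [this]
      group
    · have hsub : (s ++ [⟨k, g⟩] : List (Σ i, G i)) <:+: u.toWord.toList :=
        ht ▸ (List.suffix_cons _ _).isInfix
      have hchain := u.toWord.chain_ne.infix hsub
      obtain ⟨c, y, hy, hy'⟩ := ih (s.length + 1) (by simp [← hn, ht])
        { toList := s ++ [⟨k, g * u.head⟩]
          ne_one := by
            intro l hl
            rcases List.mem_append.1 hl with hl | hl
            · exact u.toWord.ne_one l (hsub.subset (List.mem_append_left _ hl))
            · obtain rfl := List.mem_singleton.1 hl
              exact hg
          chain_ne := by
            rw [List.isChain_append] at hchain ⊢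
            refine ⟨hchain.1, List.isChain_singleton _, ?_⟩
            intro a ha b hb
            have := hchain.2.2 a ha ⟨k, g⟩ (by simp)
            simp only [List.head?_cons, Option.mem_def, Option.some.injEq] at hb
            subst hb
            exact this } (by simp)
      refine ⟨of u.head * c, y, ?_, hy'⟩
      have : (s.map fun l => of l.snd).prod * of (g * u.head) = c * y * c⁻¹ := by
        rw [← hy]
        simp [Word.prod]
      rw [hconj, this]
      group
  · exact ⟨1, u.prod, by simp [NeWord.prod], Or.inr ⟨i, j, u, hij, rfl⟩⟩

theorem exists_of_eq_of_commute_of {i : ι} {g : G i} (hg : g ≠ 1) {y : CoprodI G}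
    (h : of g * y = y * of g) : ∃ b : G i, y = of b := by
  obtain ⟨w, rfl⟩ := Word.exists_prod_eq y
  obtain ⟨p, q, x, hx, rfl | ⟨k, l, u, hk, hl, rfl⟩⟩ := w.exists_strip i
  · exact ⟨p * q, by simp [hx]⟩
  exfalso
  rw [hx] at h
  have hg' : q * g * q⁻¹ ≠ 1 := by simpa using hg
  have hg'' : p⁻¹ * g * p ≠ 1 := by simpa using (conj_eq_one_iff (a := p⁻¹) (b := g)).not.2 hg
  have key : ((u.append hl (NeWord.singleton _ hg')).append hl.symm u.inv).prod =
      (NeWord.singleton _ hg'').prod := by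
    simp only [NeWord.append_prod, NeWord.prod_singleton, NeWord.inv_prod, map_mul, map_inv]
    have h2 := congrArg (fun z => (of p)⁻¹ * z * (of q)⁻¹ * u.prod⁻¹) h
    simp only [mul_assoc, inv_mul_cancel_left, mul_inv_cancel, mul_one] at h2 ⊢
    simpa using h2.symm
  have := congrArg List.length (NeWord.toList_eq_of_prod_eq key)
  have := u.length_pos
  simp at *
  omega

theorem NeWord.mul_prod_mul_inv_ne {i j k l : ι} (u : NeWord G i j) (v : NeWord G k l)
    (hjk : j ≠ k) (hlj : l ≠ j) : u.prod * v.prod * u.prod⁻¹ ≠ v.prod := by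
  intro h
  have key : ((u.append hjk v).append hlj u.inv).prod = v.prod := by simpa using h
  have := congrArg List.length (NeWord.toList_eq_of_prod_eq key)
  have := u.length_pos
  simp at *
  omega

theorem NeWord.exists_mem_zpowers {i j k l : ι} (u : NeWord G i j) (v : NeWord G k l)
    (hjk : j ≠ k) (hli : l ≠ i) (h : u.prod * v.prod = v.prod * u.prod) :
    ∃ g : CoprodI G, u.prod ∈ Subgroup.zpowers g ∧ v.prod ∈ Subgroup.zpowers g := by
  have hlist : u.toList ++ v.toList = v.toList ++ u.toList :=
    NeWord.toList_eq_of_prod_eq (u := u.append hjk v) (v := v.append hli u) (by simpa using h)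
  obtain ⟨g, m, n, hm, hn⟩ := FreeMonoid.exists_pow_eq_pow_of_commute
    (FreeMonoid.ofList u.toList) (FreeMonoid.ofList v.toList) (congrArg FreeMonoid.ofList hlist)
  let φ : FreeMonoid (Σ i, G i) →* CoprodI G := FreeMonoid.lift fun l => of l.snd
  have hφ {i j : ι} (w : NeWord G i j) : w.prod = φ (FreeMonoid.ofList w.toList) := by
    simp [φ, FreeMonoid.lift_apply, NeWord.prod, Word.prod, NeWord.toWord]
  refine ⟨φ g, ?_, ?_⟩
  · rw [hφ, hm, map_pow]
    exact Subgroup.npow_mem_zpowers _ _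
  · rw [hφ, hn, map_pow]
    exact Subgroup.npow_mem_zpowers _ _

theorem exists_mem_zpowers_of_commute_cyclically_reduced {i j : ι} (u : NeWord G i j)
    (hij : i ≠ j) {y : CoprodI G} (h : u.prod * y = y * u.prod) :
    ∃ g : CoprodI G, u.prod ∈ Subgroup.zpowers g ∧ y ∈ Subgroup.zpowers g := by
  obtain ⟨w, rfl⟩ := Word.exists_prod_eq y
  rcases w.eq_one_or_exists_neWord with h1 | ⟨k, l, v, rfl⟩
  · exact ⟨u.prod, Subgroup.mem_zpowers _, h1 ▸ one_mem _⟩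
  change u.prod * v.prod = v.prod * u.prod at h
  change ∃ g : CoprodI G, u.prod ∈ Subgroup.zpowers g ∧ v.prod ∈ Subgroup.zpowers g
  by_cases hjk : j = k
  · subst hjk
    have hinv : u.inv.prod * v.prod = v.prod * u.inv.prod := by
      simp only [NeWord.inv_prod]
      exact (show Commute u.prod v.prod from h).inv_left
    by_cases hlj : l = j
    · exfalso
      subst hlj
      refine u.inv.mul_prod_mul_inv_ne v hij hij.symm ?_
      rw [hinv]; simp
    · obtain ⟨g, hu, hv⟩ := u.inv.exists_mem_zpowers v hij hlj hinv
      exact ⟨g, by simpa using hu, hv⟩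
  · by_cases hli : l = i
    · exfalso
      subst hli
      refine u.mul_prod_mul_inv_ne v hjk hij ?_
      rw [h]; simp
    · exact u.exists_mem_zpowers v hjk hli h

/-- Commuting elements of a free product lie in a common cyclic subgroup or in a common conjugate
of a factor. -/
theorem mem_zpowers_or_conj_of_commute [Nonempty ι] {x y : CoprodI G} (h : x * y = y * x) :
    (∃ g : CoprodI G, x ∈ Subgroup.zpowers g ∧ y ∈ Subgroup.zpowers g) ∨
      ∃ (i : ι) (c : CoprodI G) (a b : G i), x = c * of a * c⁻¹ ∧ y = c * of b * c⁻¹ := by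
  obtain ⟨c, x', rfl, hx⟩ := exists_conj_cyclically_reduced x
  obtain ⟨y', rfl⟩ : ∃ y', y = c * y' * c⁻¹ := ⟨c⁻¹ * y * c, by group⟩
  have h' : x' * y' = y' * x' :=
    mul_left_cancel (a := c) (by simpa [← mul_assoc] using h)
  rcases hx with ⟨i, g, rfl⟩ | ⟨i, j, u, hij, rfl⟩
  · by_cases hg : g = 1
    · subst hg
      exact Or.inl ⟨c * y' * c⁻¹, by simp, Subgroup.mem_zpowers _⟩
    · obtain ⟨b, rfl⟩ := exists_of_eq_of_commute_of hg h'
      exact Or.inr ⟨i, c, g, b, rfl, rfl⟩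
  · obtain ⟨g, ⟨m, hm⟩, ⟨n, hn⟩⟩ := exists_mem_zpowers_of_commute_cyclically_reduced u hij h'
    refine Or.inl ⟨c * g * c⁻¹, ⟨m, ?_⟩, ⟨n, ?_⟩⟩
    · simp only [conj_zpow]; rw [← hm]
    · simp only [conj_zpow]; rw [← hn]

/-- The projections of two commuting elements to one of the two factors lie in a common cyclic
subgroup. -/
theorem exists_proj_mem_zpowers {G : Bool → Type*} [∀ i, Group (G i)] {x y : CoprodI G}
    (h : x * y = y * x) : ∃ (i : Bool) (g : G i),
      lift (Pi.mulSingle i (MonoidHom.id (G i))) x ∈ Subgroup.zpowers g ∧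
      lift (Pi.mulSingle i (MonoidHom.id (G i))) y ∈ Subgroup.zpowers g := by
  rcases mem_zpowers_or_conj_of_commute h with ⟨g, ⟨m, rfl⟩, ⟨n, rfl⟩⟩ | ⟨i, c, a, b, rfl, rfl⟩
  · exact ⟨true, lift (Pi.mulSingle true (MonoidHom.id (G true))) g, ⟨m, (map_zpow _ _ _).symm⟩,
      ⟨n, (map_zpow _ _ _).symm⟩⟩
  · refine ⟨!i, 1, ?_, ?_⟩ <;> simp [Pi.mulSingle_eq_of_ne]

end Monoid.CoprodI

section Suspension

variable {E : Type*} [NormedAddCommGroup E] [NormedSpace ℝ E]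

/-- A point on the ray of `E × ℝ` towards which a point of the unit ball of `E` is sent under the
identification of the ball modulo its boundary with a sphere. -/
def ballToRay (x : E) : E × ℝ := ((1 - ‖x‖) • x, 1 - 2 * ‖x‖)

theorem continuous_ballToRay : Continuous (ballToRay : E → E × ℝ) := by
  unfold ballToRay; fun_prop

theorem ballToRay_ne_zero (x : E) : ballToRay x ≠ 0 := by
  intro h
  have h2 : ‖x‖ = 1 / 2 := by
    have : 1 - 2 * ‖x‖ = 0 := congrArg Prod.snd h
    linarith
  have h1 : (1 - ‖x‖) • x = 0 := congrArg Prod.fst h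
  rw [h2, smul_eq_zero] at h1
  rcases h1 with h1 | h1
  · norm_num at h1
  · simp [h1] at h2

theorem ballToRay_of_norm_eq_one {x : E} (hx : ‖x‖ = 1) : ballToRay x = (0, -1) := by
  simp only [ballToRay, hx, Prod.mk.injEq]; norm_num

theorem eq_or_norm_eq_one_of_ballToRay {x y : E} (hx : ‖x‖ ≤ 1) (hy : ‖y‖ ≤ 1) {c : ℝ}
    (hc : 0 < c) (h : ballToRay y = c • ballToRay x) : x = y ∨ ‖x‖ = 1 ∧ ‖y‖ = 1 := by
  have h1 : (1 - ‖y‖) • y = c • (1 - ‖x‖) • x := congrArg Prod.fst h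
  have h2 : 1 - 2 * ‖y‖ = c * (1 - 2 * ‖x‖) := congrArg Prod.snd h
  have h3 : (1 - ‖y‖) * ‖y‖ = c * ((1 - ‖x‖) * ‖x‖) := by
    have := congrArg norm h1
    rwa [norm_smul, norm_smul, norm_smul, Real.norm_of_nonneg hc.le,
      Real.norm_of_nonneg (by linarith), Real.norm_of_nonneg (by linarith)] at this
  have hx0 := norm_nonneg x
  have hy0 := norm_nonneg y
  have key : (‖y‖ - ‖x‖) * ((1 - ‖x‖) * (1 - ‖y‖) + ‖x‖ * ‖y‖) = 0 := by
    have : c * ((‖y‖ - ‖x‖) * ((1 - ‖x‖) * (1 - ‖y‖) + ‖x‖ * ‖y‖)) = 0 := by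
      linear_combination (1 - ‖y‖) * ‖y‖ * (-h2) + (1 - 2 * ‖y‖) * h3
    exact (mul_eq_zero.1 this).resolve_left hc.ne'
  have hr : ‖x‖ = ‖y‖ := by
    rcases mul_eq_zero.1 key with h | h
    · linarith
    · have ha : 0 ≤ (1 - ‖x‖) * (1 - ‖y‖) := mul_nonneg (by linarith) (by linarith)
      have hb : 0 ≤ ‖x‖ * ‖y‖ := mul_nonneg hx0 hy0
      have ha' : (1 - ‖x‖) * (1 - ‖y‖) = 0 := by linarith
      have hb' : ‖x‖ * ‖y‖ = 0 := by linarith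
      rcases mul_eq_zero.1 ha' with h4 | h4 <;> rcases mul_eq_zero.1 hb' with h5 | h5 <;>
        nlinarith
  by_cases hx1 : ‖x‖ = 1
  · exact Or.inr ⟨hx1, hr ▸ hx1⟩
  · have hlt : ‖x‖ < 1 := lt_of_le_of_ne hx hx1
    have hc1 : c = 1 := by
      rw [← hr] at h2 h3
      by_cases hh : 1 - 2 * ‖x‖ = 0
      · have : (1 - ‖x‖) * ‖x‖ ≠ 0 := by
          have : ‖x‖ = 1 / 2 := by linarith
          rw [this]; norm_num
        exact mul_right_cancel₀ this (by linarith)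
      · exact mul_right_cancel₀ hh (by linarith)
    rw [hc1, one_smul, ← hr] at h1
    exact Or.inl (smul_right_injective E (by linarith : 1 - ‖x‖ ≠ 0) h1).symm

theorem exists_ballToRay_eq_smul [Nontrivial E] {z : E × ℝ} (hz : z ≠ 0) :
    ∃ (x : E) (c : ℝ), ‖x‖ ≤ 1 ∧ 0 < c ∧ ballToRay x = c • z := by
  obtain ⟨a, b⟩ := z
  by_cases ha : a = 0
  · subst ha
    have hb : b ≠ 0 := fun h => hz (by simp [h])
    rcases hb.lt_or_gt with hb | hb
    · obtain ⟨x, hx⟩ := exists_norm_eq E zero_le_one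
      exact ⟨x, -b⁻¹, hx.le, by simpa using hb, by
        rw [ballToRay_of_norm_eq_one hx]; simp [hb.ne]⟩
    · exact ⟨0, b⁻¹, by simp, by positivity, by simp [ballToRay, hb.ne']⟩
  · have ha' : 0 < ‖a‖ := norm_pos_iff.2 ha
    obtain ⟨r, ⟨hr0, hr1⟩, hr⟩ : ∃ r ∈ Set.Icc (0 : ℝ) 1,
        b * (r * (1 - r)) - ‖a‖ * (1 - 2 * r) = 0 :=
      intermediate_value_Icc zero_le_one (f := fun r : ℝ => b * (r * (1 - r)) - ‖a‖ * (1 - 2 * r))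
        (by fun_prop) ⟨by simp, by norm_num⟩
    have hr0' : 0 < r := lt_of_le_of_ne hr0 fun h => by subst h; simp at hr; exact ha hr
    have hr1' : r < 1 := lt_of_le_of_ne hr1 fun h => by
      subst h; norm_num at hr; exact ha hr
    have hn : ‖(r / ‖a‖) • a‖ = r := by
      rw [norm_smul, Real.norm_of_nonneg (by positivity)]; field_simp
    refine ⟨(r / ‖a‖) • a, (1 - r) * r / ‖a‖, hn.trans_le hr1,
      div_pos (mul_pos (by linarith) hr0') ha', ?_⟩
    simp only [ballToRay, hn, Prod.smul_mk, smul_smul, Prod.mk.injEq, smul_eq_mul]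
    refine ⟨by congr 1; ring, ?_⟩
    field_simp
    linarith

/-- The unit ball of `E` maps onto the unit sphere of `E × ℝ`, its boundary being collapsed to a
point. -/
def ballToSphere (x : E) : E × ℝ := ‖ballToRay x‖⁻¹ • ballToRay x

theorem norm_ballToSphere (x : E) : ‖ballToSphere x‖ = 1 :=
  norm_smul_inv_norm (𝕜 := ℝ) (ballToRay_ne_zero x)

theorem continuous_ballToSphere : Continuous (ballToSphere : E → E × ℝ) :=
  (continuous_ballToRay.norm.inv₀ fun x => norm_ne_zero_iff.2 (ballToRay_ne_zero x)).smul
    continuous_ballToRay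

theorem ballToSphere_of_norm_eq_one {x : E} (hx : ‖x‖ = 1) : ballToSphere x = (0, -1) := by
  simp [ballToSphere, ballToRay_of_norm_eq_one hx]

theorem eq_or_norm_eq_one_of_ballToSphere {x y : E} (hx : ‖x‖ ≤ 1) (hy : ‖y‖ ≤ 1)
    (h : ballToSphere x = ballToSphere y) : x = y ∨ ‖x‖ = 1 ∧ ‖y‖ = 1 := by
  have hx' : 0 < ‖ballToRay x‖ := norm_pos_iff.2 (ballToRay_ne_zero x)
  have hy' : 0 < ‖ballToRay y‖ := norm_pos_iff.2 (ballToRay_ne_zero y)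
  refine eq_or_norm_eq_one_of_ballToRay hx hy (c := ‖ballToRay y‖ * ‖ballToRay x‖⁻¹)
    (by positivity) ?_
  rw [mul_smul, show ‖ballToRay x‖⁻¹ • ballToRay x = _ from h, ballToSphere, smul_smul,
    mul_inv_cancel₀ hy'.ne', one_smul]

theorem exists_ballToSphere_eq [Nontrivial E] {z : E × ℝ} (hz : ‖z‖ = 1) :
    ∃ x : E, ‖x‖ ≤ 1 ∧ ballToSphere x = z := by
  obtain ⟨x, c, hx, hc, h⟩ := exists_ballToRay_eq_smul (z := z) (by rintro rfl; simp at hz)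
  refine ⟨x, hx, ?_⟩
  rw [ballToSphere, h, norm_smul, hz, mul_one, Real.norm_of_nonneg hc.le, smul_smul,
    inv_mul_cancel₀ hc.ne', one_smul]

end Suspension

section Fill

variable {ι : Type}

/-- The cube `I^ι` as the unit ball of the supremum norm. -/
def cubeToBall (x : ι → I) : ι → ℝ := fun i => 2 * (x i : ℝ) - 1

theorem continuous_cubeToBall : Continuous (cubeToBall : (ι → I) → ι → ℝ) := by
  unfold cubeToBall; fun_prop

theorem norm_cubeToBall_le [Fintype ι] (x : ι → I) : ‖cubeToBall x‖ ≤ 1 :=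
  (pi_norm_le_iff_of_nonneg zero_le_one).2 fun i => by
    rw [Real.norm_eq_abs, abs_le, cubeToBall]
    constructor <;> linarith [(x i).2.1, (x i).2.2]

theorem norm_cubeToBall_eq_one_iff [Fintype ι] {x : ι → I} :
    ‖cubeToBall x‖ = 1 ↔ x ∈ Cube.boundary ι := by
  constructor
  · intro h
    by_contra hx
    refine h.not_lt ((pi_norm_lt_iff zero_lt_one).2 fun i => ?_)
    have h0 : x i ≠ 0 := fun h => hx ⟨i, Or.inl h⟩
    have h1 : x i ≠ 1 := fun h => hx ⟨i, Or.inr h⟩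
    rw [Real.norm_eq_abs, abs_lt, cubeToBall]
    have h0' : (0 : ℝ) < x i := unitInterval.pos_iff_ne_zero.2 h0
    have h1' : (x i : ℝ) < 1 := unitInterval.lt_one_iff_ne_one.2 h1
    constructor <;> linarith
  · rintro ⟨i, hi⟩
    refine le_antisymm (norm_cubeToBall_le x) (le_trans ?_ (norm_le_pi_norm _ i))
    rcases hi with hi | hi <;> norm_num [cubeToBall, hi]

theorem cubeToBall_injective : Function.Injective (cubeToBall : (ι → I) → ι → ℝ) := by
  intro x y h
  ext i
  have : 2 * (x i : ℝ) - 1 = 2 * (y i : ℝ) - 1 := congrFun h i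
  linarith

theorem exists_cubeToBall_eq [Fintype ι] {y : ι → ℝ} (hy : ‖y‖ ≤ 1) :
    ∃ x : ι → I, cubeToBall x = y := by
  have h i : |y i| ≤ 1 := (norm_le_pi_norm y i).trans hy
  refine ⟨fun i => ⟨(y i + 1) / 2, ?_, ?_⟩, ?_⟩
  · linarith [(abs_le.1 (h i)).1]
  · linarith [(abs_le.1 (h i)).2]
  · ext i; simp only [cubeToBall]; ring

/-- A map from a sphere to a space with trivial homotopy group extends over the ball. -/
theorem exists_extension_of_subsingleton_homotopyGroup [Fintype ι] [Nonempty ι] {B : Type*} [TopologicalSpace B]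
    (hB : ∀ b : B, Subsingleton (HomotopyGroup ι B b))
    (S : C(Metric.sphere (0 : (ι → ℝ) × ℝ) 1, B)) :
    ∃ F : C(Metric.closedBall (0 : (ι → ℝ) × ℝ) 1, B),
      ∀ z, F (Set.inclusion Metric.sphere_subset_closedBall z) = S z := by
  let q : C(ι → I, Metric.sphere (0 : (ι → ℝ) × ℝ) 1) :=
    ⟨fun x => ⟨ballToSphere (cubeToBall x), by simp [norm_ballToSphere]⟩,
      (continuous_ballToSphere.comp continuous_cubeToBall).subtype_mk
        fun x => by simp [norm_ballToSphere]⟩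
  let s : Metric.sphere (0 : (ι → ℝ) × ℝ) 1 := ⟨(0, -1), by simp⟩
  have hq (x) (hx : x ∈ Cube.boundary ι) : q x = s := Subtype.ext
    (ballToSphere_of_norm_eq_one (norm_cubeToBall_eq_one_iff.2 hx))
  have hqinj (x y) (h : q x = q y) : x = y ∨ x ∈ Cube.boundary ι ∧ y ∈ Cube.boundary ι := by
    rw [← norm_cubeToBall_eq_one_iff, ← norm_cubeToBall_eq_one_iff, ← cubeToBall_injective.eq_iff]
    exact eq_or_norm_eq_one_of_ballToSphere (norm_cubeToBall_le x) (norm_cubeToBall_le y)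
      (congrArg Subtype.val h)
  have hqsurj (z) : ∃ x, q x = z := by
    obtain ⟨y, hy, hz⟩ := exists_ballToSphere_eq (z := z.1) (mem_sphere_zero_iff_norm.1 z.2)
    obtain ⟨x, rfl⟩ := exists_cubeToBall_eq hy
    exact ⟨x, Subtype.ext hz⟩
  obtain ⟨L⟩ : GenLoop.Homotopic (⟨S.comp q, fun y hy => congrArg S (hq y hy)⟩ : GenLoop ι B (S s))
    GenLoop.const := Quotient.exact ((hB (S s)).elim _ _)
  have hL (u x) (hx : x ∈ Cube.boundary ι) : L (u, x) = S s :=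
    (L.eq_fst u hx).trans (congrArg S (hq x hx))
  have hL1 (x) : L (1, x) = S s := L.apply_one x
  have hL0 (x) : L (0, x) = S (q x) := L.apply_zero x
  let Q : C(I × (ι → I), Metric.closedBall (0 : (ι → ℝ) × ℝ) 1) :=
    ⟨fun p => ⟨(1 - (p.1 : ℝ)) • (q p.2 : (ι → ℝ) × ℝ), by
      have := p.1.2.1
      have := p.1.2.2
      rw [mem_closedBall_zero_iff, norm_smul, show ‖(q p.2 : (ι → ℝ) × ℝ)‖ = 1 from
        norm_ballToSphere _, mul_one, Real.norm_of_nonneg] <;> linarith⟩, by fun_prop⟩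
  have hQn (p : I × (ι → I)) : ‖(Q p : (ι → ℝ) × ℝ)‖ = 1 - p.1 := by
    change ‖(1 - (p.1 : ℝ)) • (q p.2 : (ι → ℝ) × ℝ)‖ = _
    rw [norm_smul, show ‖(q p.2 : (ι → ℝ) × ℝ)‖ = 1 from
        norm_ballToSphere _, mul_one, Real.norm_of_nonneg (by linarith [p.1.2.2])]
  have hQsurj : Function.Surjective Q := by
    intro z
    by_cases hz : (z : (ι → ℝ) × ℝ) = 0
    · exact ⟨(1, fun _ => 0), Subtype.ext (by simp [Q, hz])⟩
    · obtain ⟨x, hx⟩ := hqsurj ⟨‖(z : (ι → ℝ) × ℝ)‖⁻¹ • (z : (ι → ℝ) × ℝ), by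
        simpa using norm_smul_inv_norm (𝕜 := ℝ) hz⟩
      have h1 : ‖(z : (ι → ℝ) × ℝ)‖ ≤ 1 := mem_closedBall_zero_iff.1 z.2
      refine ⟨(⟨1 - ‖(z : (ι → ℝ) × ℝ)‖, by linarith, by linarith [norm_nonneg z.1]⟩, x),
        Subtype.ext ?_⟩
      change (1 - (1 - ‖(z : (ι → ℝ) × ℝ)‖)) • (q x : (ι → ℝ) × ℝ) = z
      rw [hx, sub_sub_cancel, smul_smul, mul_inv_cancel₀ (norm_ne_zero_iff.2 hz), one_smul]
  have hQ : IsQuotientMap Q := Q.continuous.isClosedMap.isQuotientMap Q.continuous hQsurj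
  have hfac : Function.FactorsThrough L.toContinuousMap Q := by
    rintro ⟨u, x⟩ ⟨u', x'⟩ h
    obtain rfl : u = u' := by
      have := congrArg (fun z => ‖z.1‖) h
      simp only [hQn] at this
      exact Subtype.ext (by linarith)
    change L (u, x) = L (u, x')
    by_cases hu : u = 1
    · rw [hu, hL1, hL1]
    · have hu' : 1 - (u : ℝ) ≠ 0 := fun h => hu (Subtype.ext (sub_eq_zero.1 h).symm)
      rcases hqinj x x' (Subtype.ext (smul_right_injective _ hu' (congrArg Subtype.val h))) with
        rfl | ⟨hx, hx'⟩
      · rfl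
      · rw [hL _ _ hx, hL _ _ hx']
  refine ⟨hQ.lift _ hfac, fun z => ?_⟩
  obtain ⟨x, rfl⟩ := hqsurj z
  have : Set.inclusion Metric.sphere_subset_closedBall (q x) = Q (0, x) :=
    Subtype.ext (by simp [Q])
  rw [this, ← hL0]
  exact congrArg (fun f => f (0, x)) (hQ.lift_comp _ hfac)

end Fill

/-- Prescribed maps on the faces of a cube, compatible along the edges and equal on opposite
vertical faces, extend over the cube if the second homotopy groups of the target vanish. -/
theorem exists_cube_extension {B : Type*} [TopologicalSpace B]
    (hB : ∀ b : B, Subsingleton (HomotopyGroup (Fin 2) B b)) (A₀ A₁ α β : C(I × I, B))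
    (h₀β : ∀ i t, i = 0 ∨ i = 1 → A₀ (i, t) = β (t, 0))
    (h₁β : ∀ i t, i = 0 ∨ i = 1 → A₁ (i, t) = β (t, 1))
    (h₀α : ∀ i s, i = 0 ∨ i = 1 → A₀ (s, i) = α (s, 0))
    (h₁α : ∀ i s, i = 0 ∨ i = 1 → A₁ (s, i) = α (s, 1))
    (hαβ : ∀ i j u, i = 0 ∨ i = 1 → j = 0 ∨ j = 1 → α (i, u) = β (j, u)) :
    ∃ K : C((I × I) × I, B), (∀ x, K (x, 0) = A₀ x) ∧ (∀ x, K (x, 1) = A₁ x) ∧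
      (∀ i t u, i = 0 ∨ i = 1 → K ((i, t), u) = β (t, u)) ∧
      ∀ i s u, i = 0 ∨ i = 1 → K ((s, i), u) = α (s, u) := by
  classical
  let S : (I × I) × I → B := fun x =>
    if x.2 = 0 then A₀ x.1 else if x.2 = 1 then A₁ x.1 else
      if x.1.1 = 0 ∨ x.1.1 = 1 then β (x.1.2, x.2) else α (x.1.1, x.2)
  have hS₀ (x) : S (x, 0) = A₀ x := by simp [S]
  have hS₁ (x) : S (x, 1) = A₁ x := by simp [S]
  have hSβ (i t u) (hi : i = 0 ∨ i = 1) : S ((i, t), u) = β (t, u) := by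
    by_cases h0 : u = 0
    · rw [h0, hS₀, h₀β i t hi]
    by_cases h1 : u = 1
    · rw [h1, hS₁, h₁β i t hi]
    simp [S, h0, h1, hi]
  have hSα (i s u) (hi : i = 0 ∨ i = 1) : S ((s, i), u) = α (s, u) := by
    by_cases h0 : u = 0
    · rw [h0, hS₀, h₀α i s hi]
    by_cases h1 : u = 1
    · rw [h1, hS₁, h₁α i s hi]
    by_cases hs : s = 0 ∨ s = 1
    · rw [hSβ s i u hs, hαβ s i u hs hi]
    · simp [S, h0, h1, hs]
  have hend : IsClosed {i : I | i = 0 ∨ i = 1} := by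
    simpa [Set.insert_def] using (Set.toFinite {(0 : I), 1}).isClosed
  let bd : Set ((I × I) × I) := (({x | x.2 = 0} ∪ {x | x.2 = 1}) ∪
    {x | x.1.1 = 0 ∨ x.1.1 = 1}) ∪ {x | x.1.2 = 0 ∨ x.1.2 = 1}
  have hScont : ContinuousOn S bd := by
    have c0 : IsClosed {x : (I × I) × I | x.2 = 0} := isClosed_singleton.preimage continuous_snd
    have c1 : IsClosed {x : (I × I) × I | x.2 = 1} := isClosed_singleton.preimage continuous_snd
    have cβ : IsClosed {x : (I × I) × I | x.1.1 = 0 ∨ x.1.1 = 1} :=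
      hend.preimage (f := fun x : (I × I) × I => x.1.1) (by fun_prop)
    have cα : IsClosed {x : (I × I) × I | x.1.2 = 0 ∨ x.1.2 = 1} :=
      hend.preimage (f := fun x : (I × I) × I => x.1.2) (by fun_prop)
    refine ((ContinuousOn.union_of_isClosed ?_ ?_ c0 c1).union_of_isClosed ?_ (c0.union c1)
      cβ).union_of_isClosed ?_ ((c0.union c1).union cβ) cα
    · refine (A₀.continuous.comp continuous_fst).continuousOn.congr ?_
      rintro ⟨x, u⟩ (rfl : u = 0)
      exact hS₀ x
    · refine (A₁.continuous.comp continuous_fst).continuousOn.congr ?_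
      rintro ⟨x, u⟩ (rfl : u = 1)
      exact hS₁ x
    · refine (β.continuous.comp (g := β) (f := fun x : (I × I) × I => (x.1.2, x.2))
        (by fun_prop)).continuousOn.congr ?_
      rintro ⟨⟨s, t⟩, u⟩ hx
      exact hSβ s t u hx
    · refine (α.continuous.comp (g := α) (f := fun x : (I × I) × I => (x.1.1, x.2))
        (by fun_prop)).continuousOn.congr ?_
      rintro ⟨⟨s, t⟩, u⟩ hx
      exact hSα t s u hx
  suffices h : ∃ K : C((I × I) × I, B), ∀ x ∈ bd, K x = S x by
    obtain ⟨K, hK⟩ := h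
    refine ⟨K, fun x => ?_, fun x => ?_, fun i t u hi => ?_, fun i s u hi => ?_⟩
    · rw [hK _ (by simp [bd]), hS₀]
    · rw [hK _ (by simp [bd]), hS₁]
    · rw [hK _ (Or.inl (Or.inr hi)), hSβ i t u hi]
    · rw [hK _ (Or.inr hi), hSα i s u hi]
  let e : ℝ → I := fun r => Set.projIcc 0 1 zero_le_one ((r + 1) / 2)
  have he : Continuous e := continuous_projIcc.comp (by fun_prop)
  have he' (i : I) : e (2 * (i : ℝ) - 1) = i := by
    simp only [e, sub_add_cancel, mul_div_cancel_left₀ (i : ℝ) two_ne_zero]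
    exact Set.projIcc_val _ i
  have he1 (r : ℝ) (hr : |r| = 1) : e r = 0 ∨ e r = 1 := by
    rcases (abs_eq zero_le_one).1 hr with rfl | rfl
    · exact Or.inr (by have h := he' 1; norm_num at h; exact h)
    · exact Or.inl (by simpa using he' 0)
  have habs (i : I) : |2 * (i : ℝ) - 1| ≤ 1 :=
    abs_le.2 ⟨by linarith [i.2.1], by linarith [i.2.2]⟩
  have habs1 (i : I) (hi : i = 0 ∨ i = 1) : |2 * (i : ℝ) - 1| = 1 := by
    rcases hi with rfl | rfl <;> norm_num
  let h : (Fin 2 → ℝ) × ℝ → (I × I) × I := fun z => ((e (z.1 0), e (z.1 1)), e z.2)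
  have hh : Continuous h := by fun_prop
  have hmem : ∀ z ∈ Metric.sphere (0 : (Fin 2 → ℝ) × ℝ) 1, h z ∈ bd := by
    intro z hz
    by_contra hn
    simp only [bd, Set.mem_union, Set.mem_ofPred_eq, not_or, h] at hn
    have hz' : ‖z‖ = 1 := mem_sphere_zero_iff_norm.1 hz
    have hle : ‖z‖ ≤ 1 := hz'.le
    rw [Prod.norm_def, max_le_iff] at hle
    have l (r : ℝ) (hr : ‖r‖ ≤ 1) (h0 : ¬ e r = 0) (h1 : ¬ e r = 1) : ‖r‖ < 1 :=
      lt_of_le_of_ne hr fun h => (he1 r h).elim h0 h1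
    refine hz'.not_lt (max_lt ((pi_norm_lt_iff zero_lt_one).2 fun i => ?_) ?_)
    · have := (norm_le_pi_norm z.1 i).trans hle.1
      fin_cases i
      · exact l _ this hn.1.2.1 hn.1.2.2
      · exact l _ this hn.2.1 hn.2.2
    · exact l _ hle.2 hn.1.1.1 hn.1.1.2
  obtain ⟨F, hF⟩ := exists_extension_of_subsingleton_homotopyGroup hB
    ⟨fun z => S (h z), hScont.comp_continuous (hh.comp continuous_subtype_val)
      fun z => hmem z z.2⟩
  let k : (I × I) × I → (Fin 2 → ℝ) × ℝ := fun x =>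
    (![2 * (x.1.1 : ℝ) - 1, 2 * (x.1.2 : ℝ) - 1], 2 * (x.2 : ℝ) - 1)
  have hk : Continuous k := by
    refine Continuous.prodMk (continuous_pi fun i => ?_) (by fun_prop)
    fin_cases i <;> simp <;> fun_prop
  have hkle (x) : ‖k x‖ ≤ 1 := by
    refine max_le ((pi_norm_le_iff_of_nonneg zero_le_one).2 fun i => ?_) (habs _)
    fin_cases i <;> exact habs _
  have hkh (x) : h (k x) = x := by simp [h, k, he']
  refine ⟨F.comp ⟨fun x => ⟨k x, mem_closedBall_zero_iff.2 (hkle x)⟩, hk.subtype_mk _⟩,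
    fun x hx => ?_⟩
  have hk1 : ‖k x‖ = 1 := by
    refine le_antisymm (hkle x) ?_
    rcases hx with ((hx | hx) | hx) | hx
    · exact (habs1 _ (Or.inl hx)).ge.trans (le_max_right _ _)
    · exact (habs1 _ (Or.inr hx)).ge.trans (le_max_right _ _)
    · exact ((habs1 _ hx).ge.trans (norm_le_pi_norm (k x).1 0)).trans (le_max_left _ _)
    · exact ((habs1 _ hx).ge.trans (norm_le_pi_norm (k x).1 1)).trans (le_max_left _ _)
  exact (hF ⟨k x, mem_sphere_zero_iff_norm.2 hk1⟩).trans (congrArg S (hkh x))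

theorem Path.Homotopic.of_apply_eq {X : Type*} [TopologicalSpace X] {x y x' y' : X}
    {p q : Path x y} (h : p.Homotopic q) {p' q' : Path x' y'} (hp : ∀ t, p' t = p t)
    (hq : ∀ t, q' t = q t) : p'.Homotopic q' := by
  obtain rfl : x' = x := by simpa using hp 0
  obtain rfl : y' = y := by simpa using hp 1
  rwa [Path.ext (funext hp), Path.ext (funext hq)]

namespace UnitAddCircle

/-- The loop winding `m` times around the circle. -/
def loop (m : ℤ) : Path (0 : UnitAddCircle) 0 where
  toFun u := ((m * u : ℝ) : UnitAddCircle)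
  continuous_toFun := (AddCircle.continuous_mk' 1).comp (by fun_prop)
  source' := by simp
  target' := by simp

theorem loop_apply (m : ℤ) (u : I) : loop m u = m • ((u : ℝ) : UnitAddCircle) := by
  rw [← AddCircle.coe_zsmul, zsmul_eq_mul]; rfl

/-- The class of `loop m` in the fundamental group. -/
def loopClass (m : ℤ) : FundamentalGroup UnitAddCircle 0 :=
  Path.Homotopic.Quotient.mk (loop m)

theorem coe_intCast (m : ℤ) : ((m : ℝ) : UnitAddCircle) = 0 :=
  (AddCircle.coe_eq_zero_iff 1).2 ⟨m, by simp⟩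

theorem loopClass_add (m n : ℤ) : loopClass (m + n) = loopClass n * loopClass m := by
  let c : C(ℝ, UnitAddCircle) := ⟨fun x => x, AddCircle.continuous_mk' 1⟩
  have h : ((Path.segment (0 : ℝ) (m + n)).map c.continuous).Homotopic
      (((Path.segment (0 : ℝ) m).trans (Path.segment (m : ℝ) (m + n))).map c.continuous) :=
    (SimplyConnectedSpace.paths_homotopic _ _).map c
  refine Quotient.sound (h.of_apply_eq (p' := loop (m + n)) (q' := (loop m).trans (loop n))
    (fun t => ?_) fun t => ?_)
  · change ((((m + n : ℤ) : ℝ) * t : ℝ) : UnitAddCircle) = (Path.segment (0 : ℝ) (m + n) t : ℝ)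
    simp [AffineMap.lineMap_apply, mul_comm]
  · simp only [Path.map_trans, Path.trans_apply]
    split_ifs
    · refine (loop_apply m _).trans ?_
      rw [← AddCircle.coe_zsmul, zsmul_eq_mul]
      refine congrArg (fun x : ℝ => (x : UnitAddCircle)) ?_
      simp [AffineMap.lineMap_apply, mul_comm]
    · refine (loop_apply n _).trans ?_
      rw [← AddCircle.coe_zsmul, zsmul_eq_mul, ← add_zero ((_ : ℝ) : UnitAddCircle),
        ← coe_intCast m, ← AddCircle.coe_add]
      refine congrArg (fun x : ℝ => (x : UnitAddCircle)) ?_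
      simp [AffineMap.lineMap_apply, mul_comm]

theorem loopClass_eq_zpow (m : ℤ) : loopClass m = loopClass 1 ^ m := by
  let φ : Multiplicative ℤ →* FundamentalGroup UnitAddCircle 0 :=
    MonoidHom.mk' (fun m => loopClass m.toAdd) fun a b => by
      rw [toAdd_mul, add_comm, loopClass_add]
  have := map_zpow φ (Multiplicative.ofAdd 1) m
  rwa [← ofAdd_zsmul, smul_eq_mul, mul_one] at this

/-- The circle as a quotient of the unit interval. -/
def ofInterval : C(I, UnitAddCircle) :=
  ⟨fun u => (u : ℝ), (AddCircle.continuous_mk' 1).comp continuous_subtype_val⟩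

theorem ofInterval_apply (u : I) : ofInterval u = ((u : ℝ) : UnitAddCircle) := rfl

theorem ofInterval_surjective : Function.Surjective ofInterval := by
  intro x
  obtain ⟨b, hb, rfl⟩ := AddCircle.eq_coe_Ico x
  exact ⟨⟨b, hb.1, hb.2.le⟩, rfl⟩

theorem ofInterval_end {i : I} (hi : i = 0 ∨ i = 1) : ofInterval i = 0 := by
  rcases hi with rfl | rfl <;> simp [ofInterval_apply]

theorem eq_or_of_ofInterval_eq {s t : I} (h : ofInterval s = ofInterval t) :
    s = t ∨ (s = 0 ∨ s = 1) ∧ (t = 0 ∨ t = 1) := by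
  have aux {s t : I} (h : ofInterval s = ofInterval t) (hs : s ≠ 1) (ht : t = 1) : s = 0 := by
    have h0 : ofInterval s = ofInterval 0 := by
      rw [h, ht, ofInterval_end (Or.inr rfl), ofInterval_end (Or.inl rfl)]
    exact Subtype.ext ((AddCircle.coe_eq_coe_iff_of_mem_Ico (p := (1 : ℝ)) (a := 0)
      ⟨s.2.1, by simpa using unitInterval.lt_one_iff_ne_one.2 hs⟩ (by simp)).1 h0)
  by_cases hs : s = 1 <;> by_cases ht : t = 1
  · exact Or.inl (hs.trans ht.symm)
  · exact Or.inr ⟨Or.inr hs, Or.inl (aux h.symm ht hs)⟩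
  · exact Or.inr ⟨Or.inl (aux h hs ht), Or.inr ht⟩
  · exact Or.inl (Subtype.ext ((AddCircle.coe_eq_coe_iff_of_mem_Ico (p := (1 : ℝ)) (a := 0)
      ⟨s.2.1, by simpa using unitInterval.lt_one_iff_ne_one.2 hs⟩
      ⟨t.2.1, by simpa using unitInterval.lt_one_iff_ne_one.2 ht⟩).1 h))

theorem exists_comp_ofInterval_eq {B : Type*} [TopologicalSpace B] {b : B} (γ : Path b b) :
    ∃ g : C(UnitAddCircle, B), ∀ u, g (ofInterval u) = γ u := by
  have hq : IsQuotientMap ofInterval := ofInterval.continuous.isClosedMap.isQuotientMap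
    ofInterval.continuous ofInterval_surjective
  have hfac : Function.FactorsThrough γ.toContinuousMap ofInterval := by
    intro s t h
    have l {i : I} (hi : i = 0 ∨ i = 1) : γ i = b := by rcases hi with rfl | rfl <;> simp
    rcases eq_or_of_ofInterval_eq h with rfl | ⟨hs, ht⟩
    · rfl
    · exact (l hs).trans (l ht).symm
  exact ⟨hq.lift _ hfac, fun u => congrArg (fun f => f u) (hq.lift_comp _ hfac)⟩

/-- The first coordinate loop of the torus. -/
def torusLoop₁ : Path (0 : UnitAddCircle × UnitAddCircle) 0 := (loop 1).prod (Path.refl 0)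

/-- The second coordinate loop of the torus. -/
def torusLoop₂ : Path (0 : UnitAddCircle × UnitAddCircle) 0 := (Path.refl 0).prod (loop 1)

theorem torusLoop₁_apply (t : I) : torusLoop₁ t = (ofInterval t, 0) :=
  Prod.ext ((loop_apply 1 t).trans (one_zsmul _)) rfl

theorem torusLoop₂_apply (t : I) : torusLoop₂ t = (0, ofInterval t) :=
  Prod.ext rfl ((loop_apply 1 t).trans (one_zsmul _))

/-- A map from the torus to a space without second homotopy which sends the two coordinate loops
to powers of one element of the fundamental group factors through the circle up to homotopy. -/
theorem exists_homotopic_comp_of_mem_zpowers {B : Type*} [TopologicalSpace B]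
    (hB : ∀ b : B, Subsingleton (HomotopyGroup (Fin 2) B b))
    (g : C(UnitAddCircle × UnitAddCircle, B)) (γ : FundamentalGroup B (g 0))
    (h₁ : FundamentalGroup.map g 0 (Path.Homotopic.Quotient.mk torusLoop₁) ∈ Subgroup.zpowers γ)
    (h₂ : FundamentalGroup.map g 0 (Path.Homotopic.Quotient.mk torusLoop₂) ∈ Subgroup.zpowers γ) :
    ∃ (k : C(UnitAddCircle, B)) (m : C(UnitAddCircle × UnitAddCircle, UnitAddCircle)),
      g.Homotopic (k.comp m) := by
  obtain ⟨Γ, hΓ⟩ := Path.Homotopic.Quotient.mk_surjective γ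
  obtain ⟨k, hk⟩ := exists_comp_ofInterval_eq Γ
  have hk0 : k 0 = g 0 := by
    simpa [ofInterval_end (Or.inl rfl)] using hk 0
  obtain ⟨p, hp⟩ := h₁
  obtain ⟨q, hq⟩ := h₂
  have hpow (m : ℤ) : γ ^ m = Path.Homotopic.Quotient.mk
      (((loop m).map k.continuous).cast hk0.symm hk0.symm) := by
    have h1 : FundamentalGroup.mapOfEq k hk0 (loopClass 1) = γ := by
      rw [← hΓ, FundamentalGroup.mapOfEq_apply]
      refine congrArg Path.Homotopic.Quotient.mk (Path.ext (funext fun u => ?_))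
      simpa [loop_apply, ofInterval_apply] using hk u
    rw [← h1, ← map_zpow, ← loopClass_eq_zpow, FundamentalGroup.mapOfEq_apply]
    rfl
  obtain ⟨P⟩ : (torusLoop₁.map g.continuous).Homotopic
      (((loop p).map k.continuous).cast hk0.symm hk0.symm) :=
    Path.Homotopic.Quotient.exact (hp.symm.trans (hpow p))
  obtain ⟨Q⟩ : (torusLoop₂.map g.continuous).Homotopic
      (((loop q).map k.continuous).cast hk0.symm hk0.symm) :=
    Path.Homotopic.Quotient.exact (hq.symm.trans (hpow q))
  let m : C(UnitAddCircle × UnitAddCircle, UnitAddCircle) :=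
    ⟨fun x => p • x.1 + q • x.2, by fun_prop⟩
  refine ⟨k, m, ?_⟩
  let sw : C(I × I, I × I) := ⟨Prod.swap, continuous_swap⟩
  have hP0 (s) : P (0, s) = g (ofInterval s, 0) :=
    (P.apply_zero s).trans (congrArg g (torusLoop₁_apply s))
  have hP1 (s) : P (1, s) = k (p • ofInterval s) :=
    (P.apply_one s).trans (congrArg k (loop_apply p s))
  have hQ0 (s) : Q (0, s) = g (0, ofInterval s) :=
    (Q.apply_zero s).trans (congrArg g (torusLoop₂_apply s))
  have hQ1 (s) : Q (1, s) = k (q • ofInterval s) :=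
    (Q.apply_one s).trans (congrArg k (loop_apply q s))
  have hPe (i u) (hi : i = 0 ∨ i = 1) : P (u, i) = g 0 := by
    rcases hi with rfl | rfl <;> simp
  have hQe (i u) (hi : i = 0 ∨ i = 1) : Q (u, i) = g 0 := by
    rcases hi with rfl | rfl <;> simp
  let e : C(I × I, UnitAddCircle × UnitAddCircle) := ofInterval.prodMap ofInterval
  obtain ⟨K, hK0, hK1, hKβ, hKα⟩ := exists_cube_extension hB (g.comp e) (k.comp (m.comp e))
    (P.toContinuousMap.comp sw) (Q.toContinuousMap.comp sw)
    (fun i t hi => by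
      change g (ofInterval i, ofInterval t) = Q (0, t)
      rw [hQ0, ofInterval_end hi])
    (fun i t hi => by
      change k (p • ofInterval i + q • ofInterval t) = Q (1, t)
      rw [hQ1, ofInterval_end hi, smul_zero, zero_add])
    (fun i s hi => by
      change g (ofInterval s, ofInterval i) = P (0, s)
      rw [hP0, ofInterval_end hi])
    (fun i s hi => by
      change k (p • ofInterval s + q • ofInterval i) = P (1, s)
      rw [hP1, ofInterval_end hi, smul_zero, add_zero])
    (fun i j u hi hj => (hPe i u hi).trans (hQe j u hj).symm)
  let E : C((I × I) × I, (UnitAddCircle × UnitAddCircle) × I) := e.prodMap (.id I)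
  have hEsurj : Function.Surjective E :=
    (ofInterval_surjective.prodMap ofInterval_surjective).prodMap Function.surjective_id
  have hE : IsQuotientMap E := E.continuous.isClosedMap.isQuotientMap E.continuous hEsurj
  have hfac : Function.FactorsThrough K E := by
    rintro ⟨⟨s, t⟩, u⟩ ⟨⟨s', t'⟩, u'⟩ h
    obtain rfl : u = u' := congrArg Prod.snd h
    have hs : ofInterval s = ofInterval s' := congrArg (fun x => x.1.1) h
    have ht : ofInterval t = ofInterval t' := congrArg (fun x => x.1.2) h
    have e1 : K ((s, t), u) = K ((s', t), u) := by
      rcases eq_or_of_ofInterval_eq hs with rfl | ⟨h1, h2⟩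
      · rfl
      · rw [hKβ _ _ _ h1, hKβ _ _ _ h2]
    have e2 : K ((s', t), u) = K ((s', t'), u) := by
      rcases eq_or_of_ofInterval_eq ht with rfl | ⟨h1, h2⟩
      · rfl
      · rw [hKα _ _ _ h1, hKα _ _ _ h2]
    exact e1.trans e2
  have hlift (x : I × I) (u : I) : hE.lift K hfac (e x, u) = K (x, u) :=
    congrArg (fun f => f (x, u)) (hE.lift_comp K hfac)
  have hsurj : Function.Surjective e := ofInterval_surjective.prodMap ofInterval_surjective
  refine ⟨⟨(hE.lift K hfac).comp ⟨Prod.swap, continuous_swap⟩, fun x => ?_, fun x => ?_⟩⟩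
  · obtain ⟨x, rfl⟩ := hsurj x
    exact (hlift x 0).trans (hK0 x)
  · obtain ⟨x, rfl⟩ := hsurj x
    exact (hlift x 1).trans (hK1 x)

end UnitAddCircle

section Grid

/-- The ordered product `f (k - 1) * ⋯ * f 1 * f 0`. -/
def leftProd {M : Type*} [Monoid M] (f : ℕ → M) : ℕ → M
  | 0 => 1
  | k + 1 => f k * leftProd f k

theorem map_leftProd {M M' : Type*} [Monoid M] [Monoid M'] (φ : M →* M') (f : ℕ → M) (k : ℕ) :
    φ (leftProd f k) = leftProd (fun j => φ (f j)) k := by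
  induction k with
  | zero => simp [leftProd]
  | succ k ih => simp [leftProd, ih]

theorem leftProd_telescope {M S : Type*} [Group M] {a : S → S → M}
    (ha : ∀ x y z, a x z = a y z * a x y) (x : ℕ → S) (k : ℕ) :
    leftProd (fun j => a (x j) (x (j + 1))) k = a (x 0) (x k) := by
  induction k with
  | zero => simpa [leftProd, eq_comm] using ha (x 0) (x 0) (x 0)
  | succ k ih => rw [leftProd, ih, ← ha]

/-- If the small squares of a doubly periodic grid of group elements commute, then so do the
products along its sides. -/
theorem leftProd_mul_comm_of_squares {M : Type*} [Group M] {n : ℕ} {h v : ℕ → ℕ → M}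
    (sq : ∀ i < n, ∀ j < n, v (i + 1) j * h i j = h i (j + 1) * v i j)
    (hv : ∀ j < n, v n j = v 0 j) (hh : ∀ i, h i n = h i 0) :
    leftProd (v 0) n * leftProd (fun i => h i 0) n =
      leftProd (fun i => h i 0) n * leftProd (v 0) n := by
  have strip (j) (hj : j < n) (k) (hk : k ≤ n) :
      v k j * leftProd (fun i => h i j) k = leftProd (fun i => h i (j + 1)) k * v 0 j := by
    induction k with
    | zero => simp [leftProd]
    | succ k ih =>
      rw [leftProd, leftProd, ← mul_assoc, sq k hk j hj, mul_assoc, ih (by lia), mul_assoc]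
  have total (k) (hk : k ≤ n) : leftProd (v 0) k * leftProd (fun i => h i 0) n =
      leftProd (fun i => h i k) n * leftProd (v 0) k := by
    induction k with
    | zero => simp [leftProd]
    | succ k ih =>
      rw [leftProd, mul_assoc, ih (by lia), ← mul_assoc, ← hv k hk, strip k hk n le_rfl,
        hv k hk, mul_assoc]
  simpa only [hh] using total n le_rfl

open Monoid

theorem exists_commute_lift_eq {G : Bool → Type*} [∀ i, Group (G i)]
    {a : ∀ i, ℝ × ℝ → ℝ × ℝ → G i} (ha : ∀ i x y z, a i x z = a i y z * a i x y)
    (hp₁ : ∀ i x y, a i (x + (1, 0)) (y + (1, 0)) = a i x y)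
    (hp₂ : ∀ i x y, a i (x + (0, 1)) (y + (0, 1)) = a i x y)
    {δ : ℝ} (hδ : 0 < δ) (hloc : ∀ x ∈ Set.Icc (0 : ℝ × ℝ) 1, ∃ i, ∀ y ∈ Metric.ball x δ,
      ∀ z ∈ Metric.ball x δ, a i y z = 1) :
    ∃ x y : CoprodI G, x * y = y * x ∧ ∀ i,
      CoprodI.lift (Pi.mulSingle i (MonoidHom.id (G i))) x = a i 0 (1, 0) ∧
      CoprodI.lift (Pi.mulSingle i (MonoidHom.id (G i))) y = a i 0 (0, 1) := by
  let c (x y : ℝ × ℝ) : CoprodI G := CoprodI.of (a false x y) * CoprodI.of (a true x y)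
  have hproj (i : Bool) (x y) :
      CoprodI.lift (Pi.mulSingle i (MonoidHom.id (G i))) (c x y) = a i x y := by
    cases i <;> simp [c]
  have hc (x) (hx : x ∈ Set.Icc (0 : ℝ × ℝ) 1) (u v w) (hu : u ∈ Metric.ball x δ)
      (hv : v ∈ Metric.ball x δ) (hw : w ∈ Metric.ball x δ) : c u w = c v w * c u v := by
    obtain ⟨i, hi⟩ := hloc x hx
    cases i <;> simp [c, hi _ hu _ hv, hi _ hu _ hw, hi _ hv _ hw, ← map_mul, ← ha]
  obtain ⟨n, hn⟩ := exists_nat_one_div_lt hδ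
  have hn0 : (0 : ℝ) < n + 1 := by positivity
  let P (i j : ℕ) : ℝ × ℝ := (i / (n + 1), j / (n + 1))
  have hPmem (i) (hi : i < n + 1) (j) (hj : j < n + 1) : P i j ∈ Set.Icc (0 : ℝ × ℝ) 1 := by
    have hi' : (i : ℝ) ≤ n + 1 := by exact_mod_cast hi.le
    have hj' : (j : ℝ) ≤ n + 1 := by exact_mod_cast hj.le
    refine ⟨⟨by positivity, by positivity⟩, ?_, ?_⟩ <;> simpa [P] using div_le_one_of_le₀ ‹_› hn0.le
  have hball (i j) : P i j ∈ Metric.ball (P i j) δ ∧ P (i + 1) j ∈ Metric.ball (P i j) δ ∧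
      P i (j + 1) ∈ Metric.ball (P i j) δ ∧ P (i + 1) (j + 1) ∈ Metric.ball (P i j) δ := by
    have key (k : ℕ) : |((k + 1 : ℕ) : ℝ) / (n + 1) - k / (n + 1)| < δ := by
      rw [← sub_div, Nat.cast_succ, add_sub_cancel_left, abs_of_pos (by positivity)]
      exact hn
    simp only [Metric.mem_ball, Prod.dist_eq, Real.dist_eq, sup_lt_iff, P, sub_self, abs_zero,
      key, hδ, and_self]
  have hP₁ (j) : P (n + 1) j = P 0 j + (1, 0) := by
    simp [P, div_self hn0.ne']
  have hP₂ (i) : P i (n + 1) = P i 0 + (0, 1) := by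
    simp [P, div_self hn0.ne']
  have hcomm := leftProd_mul_comm_of_squares (n := n + 1) (h := fun i j => c (P i j) (P (i + 1) j))
    (v := fun i j => c (P i j) (P i (j + 1)))
    (fun i hi j hj => by
      obtain ⟨h1, h2, h3, h4⟩ := hball i j
      rw [← hc _ (hPmem i hi j hj) _ _ _ h1 h2 h4, ← hc _ (hPmem i hi j hj) _ _ _ h1 h3 h4])
    (fun j _ => by simp only [hP₁, c, hp₁]) (fun i => by simp only [hP₂, c, hp₂])
  refine ⟨_, _, hcomm.symm, fun i => ⟨?_, ?_⟩⟩
  · rw [map_leftProd]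
    simp only [hproj]
    rw [leftProd_telescope (ha i) (fun k => P k 0), hP₁]
    simp [P, ← Prod.zero_eq_mk]
  · rw [map_leftProd]
    simp only [hproj]
    rw [leftProd_telescope (ha i) (fun k => P 0 k), hP₂]
    simp [P, ← Prod.zero_eq_mk]

end Grid

section PathClass

variable {N B : Type*} [TopologicalSpace N] [TopologicalSpace B]

/-- The element of the fundamental group obtained by mapping a path to `B` and closing it up by
the paths `τ` to the base point. -/
def pathClass (q : C(N, B)) {b : B} (τ : ∀ x, FundamentalGroupoid.mk b ⟶ .mk (q x)) {x y : N}
    (p : Path x y) : FundamentalGroup B b :=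
  τ x ≫ FundamentalGroupoid.fromPath (.mk (p.map q.continuous)) ≫ inv (τ y)

variable {q : C(N, B)} {b : B} {τ : ∀ x, FundamentalGroupoid.mk b ⟶ .mk (q x)}

theorem pathClass_trans {x y z : N} (p : Path x y) (p' : Path y z) :
    pathClass q τ (p.trans p') = pathClass q τ p' * pathClass q τ p := by
  have h : FundamentalGroupoid.fromPath (.mk ((p.trans p').map q.continuous)) =
      FundamentalGroupoid.fromPath (.mk (p.map q.continuous)) ≫
        FundamentalGroupoid.fromPath (.mk (p'.map q.continuous)) := by
    rw [Path.map_trans]; rfl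
  rw [End.mul_def]
  simp only [pathClass, h, Category.assoc, IsIso.inv_hom_id_assoc]

theorem pathClass_eq_of_homotopic {x y : N} {p p' : Path x y} (h : p.Homotopic p') :
    pathClass q τ p = pathClass q τ p' := by
  rw [pathClass, Path.Homotopic.Quotient.eq.2 (h.map q), pathClass]

theorem pathClass_eq_of_apply_eq {x y x' y' : N} {p : Path x y} {p' : Path x' y'}
    (h : ∀ t, p t = p' t) : pathClass q τ p = pathClass q τ p' := by
  obtain rfl : x = x' := by simpa using h 0
  obtain rfl : y = y' := by simpa using h 1
  rw [Path.ext (funext h)]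

/-- If `q` factors through a simply connected space on `U`, then the paths to the base point can be
chosen such that `pathClass` is trivial on the paths in `U`. -/
theorem exists_pathClass_eq_one [PathConnectedSpace B] {V : Type*} [TopologicalSpace V]
    [SimplyConnectedSpace V] (q : C(N, B)) (b : B) {U : Set N} (l : C(U, V)) (κ : C(V, B))
    (h : ∀ x : U, q x = κ (l x)) :
    ∃ τ : ∀ x, FundamentalGroupoid.mk b ⟶ .mk (q x),
      ∀ {x y : N} (p : Path x y), (∀ t, p t ∈ U) → pathClass q τ p = 1 := by
  classical
  obtain ⟨v⟩ : Nonempty V := inferInstance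
  let P₀ : Path b (κ v) := PathConnectedSpace.somePath _ _
  let A (x : U) : Path v (l x) := PathConnectedSpace.somePath _ _
  let τ (x : N) : FundamentalGroupoid.mk b ⟶ .mk (q x) :=
    Path.Homotopic.Quotient.mk (if hx : x ∈ U then
      (P₀.trans ((A ⟨x, hx⟩).map κ.continuous)).cast rfl (h ⟨x, hx⟩)
      else PathConnectedSpace.somePath b (q x))
  refine ⟨τ, fun {x y} p hp => ?_⟩
  have hx : x ∈ U := by simpa using hp 0
  have hy : y ∈ U := by simpa using hp 1
  let p' : Path (⟨x, hx⟩ : U) ⟨y, hy⟩ :=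
    ⟨⟨fun t => ⟨p t, hp t⟩, by fun_prop⟩, Subtype.ext p.source, Subtype.ext p.target⟩
  let r : Path (l ⟨x, hx⟩) (l ⟨y, hy⟩) := p'.map l.continuous
  have h1 : ((P₀.trans ((A ⟨x, hx⟩).map κ.continuous)).trans (r.map κ.continuous)).Homotopic
      (P₀.trans ((A ⟨y, hy⟩).map κ.continuous)) := by
    refine Path.Homotopic.trans ⟨Path.Homotopy.transAssoc _ _ _⟩
      (Path.Homotopic.hcomp (Path.Homotopic.refl _) ?_)
    rw [← Path.map_trans]
    exact (SimplyConnectedSpace.paths_homotopic _ _).map κ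
  have h2 : τ x ≫ FundamentalGroupoid.fromPath (.mk (p.map q.continuous)) = τ y := by
    refine Path.Homotopic.Quotient.eq.2 (h1.of_apply_eq (fun t => ?_) fun t => ?_)
    · rw [dif_pos hx]
      rw [Path.trans_apply, Path.trans_apply]
      split_ifs
      · rfl
      · exact h ⟨p _, hp _⟩
    · rw [dif_pos hy]
      rfl
  rw [pathClass, ← Category.assoc, h2, IsIso.hom_inv_id]
  rfl

end PathClass

namespace UnitAddCircle

/-- The universal covering of the torus. -/
def torusCover : C(ℝ × ℝ, UnitAddCircle × UnitAddCircle) :=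
  ⟨fun x => (x.1, x.2), by
    exact ((AddCircle.continuous_mk' 1).comp continuous_fst).prodMk
      ((AddCircle.continuous_mk' 1).comp continuous_snd)⟩

theorem torusCover_apply (x : ℝ × ℝ) :
    torusCover x = ((x.1 : UnitAddCircle), (x.2 : UnitAddCircle)) := rfl

theorem torusCover_add_fst (x : ℝ × ℝ) : torusCover (x + (1, 0)) = torusCover x := by
  simp [torusCover_apply]

theorem torusCover_add_snd (x : ℝ × ℝ) : torusCover (x + (0, 1)) = torusCover x := by
  simp [torusCover_apply]

/-- Consider two maps `q i` from a space covered by two open sets such that each `q i` factors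
through a simply connected space on one of these sets. Then for every torus in that space one of
the `q i` sends both coordinate loops into a cyclic subgroup of the fundamental group. -/
theorem exists_map_torusLoop_mem_zpowers {N : Type*} [TopologicalSpace N] {B : Bool → Type*}
    [∀ i, TopologicalSpace (B i)] [∀ i, PathConnectedSpace (B i)] (q : ∀ i, C(N, B i))
    {U : Bool → Set N} (hU : ∀ i, IsOpen (U i)) (hcov : ∀ x, ∃ i, x ∈ U i)
    {V : Type*} [TopologicalSpace V] [SimplyConnectedSpace V] (l : ∀ i, C(U i, V))
    (κ : ∀ i, C(V, B i)) (h : ∀ i (x : U i), q i x = κ i (l i x))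
    (f : C(UnitAddCircle × UnitAddCircle, N)) :
    ∃ (i : Bool) (γ : FundamentalGroup (B i) (((q i).comp f) 0)),
      FundamentalGroup.map ((q i).comp f) 0 (Path.Homotopic.Quotient.mk torusLoop₁) ∈
        Subgroup.zpowers γ ∧
      FundamentalGroup.map ((q i).comp f) 0 (Path.Homotopic.Quotient.mk torusLoop₂) ∈
        Subgroup.zpowers γ := by
  choose τ hτ using fun i => exists_pathClass_eq_one (q i) (q i (f 0)) (l i) (κ i) (h i)
  let F : C(ℝ × ℝ, N) := f.comp torusCover
  let a (i : Bool) (x y : ℝ × ℝ) : FundamentalGroup (B i) (q i (f 0)) :=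
    pathClass (q i) (τ i) ((Path.segment x y).map F.continuous)
  have ha (i x y z) : a i x z = a i y z * a i x y := by
    rw [← pathClass_trans, ← Path.map_trans]
    exact pathClass_eq_of_homotopic ((SimplyConnectedSpace.paths_homotopic _ _).map F)
  have hper {e : ℝ × ℝ} (he : ∀ x, torusCover (x + e) = torusCover x) (i x y) :
      a i (x + e) (y + e) = a i x y := by
    refine pathClass_eq_of_apply_eq fun t => ?_
    have : Path.segment (x + e) (y + e) t = Path.segment x y t + e := by
      simp [AffineMap.lineMap_apply]
      abel
    exact (congrArg F this).trans (congrArg f (he _))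
  obtain ⟨δ, hδ, hδU⟩ := lebesgue_number_lemma_of_metric (s := Set.Icc (0 : ℝ × ℝ) 1)
    (c := fun i => F ⁻¹' U i) isCompact_Icc (fun i => (hU i).preimage F.continuous)
    (fun x _ => Set.mem_iUnion.2 (hcov (F x)))
  have hloc (x) (hx : x ∈ Set.Icc (0 : ℝ × ℝ) 1) : ∃ i, ∀ y ∈ Metric.ball x δ,
      ∀ z ∈ Metric.ball x δ, a i y z = 1 := by
    obtain ⟨i, hi⟩ := hδU x hx
    refine ⟨i, fun y hy z hz => hτ i _ fun t => hi ?_⟩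
    exact (convex_ball x δ).segment_subset hy hz (Path.range_segment y z ▸ Set.mem_range_self t)
  obtain ⟨x, y, hxy, hproj⟩ := exists_commute_lift_eq ha (hper torusCover_add_fst)
    (hper torusCover_add_snd) hδ hloc
  obtain ⟨i, g, hx, hy⟩ := Monoid.CoprodI.exists_proj_mem_zpowers hxy
  rw [(hproj i).1] at hx
  rw [(hproj i).2] at hy
  let T : FundamentalGroup (B i) (q i (f 0)) := τ i (f 0)
  have hconj (p : Path (0 : UnitAddCircle × UnitAddCircle) 0) :
      FundamentalGroup.map ((q i).comp f) 0 (Path.Homotopic.Quotient.mk p) =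
        MulAut.conj T (pathClass (q i) (τ i) (p.map f.continuous)) := by
    rw [MulAut.conj_apply, eq_mul_inv_iff_mul_eq]
    have hs (t x : FundamentalGroupoid.mk (q i (f 0)) ⟶ .mk (q i (f 0))) :
        t ≫ x = (t ≫ x ≫ inv t) ≫ t := by simp
    exact hs _ _
  have hmem {p : Path (0 : UnitAddCircle × UnitAddCircle) 0}
      (hp : pathClass (q i) (τ i) (p.map f.continuous) ∈ Subgroup.zpowers g) :
      FundamentalGroup.map ((q i).comp f) 0 (Path.Homotopic.Quotient.mk p) ∈
        Subgroup.zpowers (MulAut.conj T g) := by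
    obtain ⟨m, hm⟩ := hp
    rw [hconj, ← hm]
    exact ⟨m, (map_zpow _ _ _).symm⟩
  refine ⟨i, MulAut.conj T g, hmem ?_, hmem ?_⟩
  · convert hx using 1
    refine pathClass_eq_of_apply_eq fun t => congrArg f ?_
    simp [torusLoop₁_apply, ofInterval_apply, torusCover_apply, AffineMap.lineMap_apply]
  · convert hy using 1
    refine pathClass_eq_of_apply_eq fun t => congrArg f ?_
    simp [torusLoop₂_apply, ofInterval_apply, torusCover_apply, AffineMap.lineMap_apply]

end UnitAddCircle

/-- The unit sphere in the Euclidean plane is the circle. -/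
def unitSphereHomeomorphUnitAddCircle : unitSphere 1 ≃ₜ UnitAddCircle :=
  (Complex.orthonormalBasisOneI.repr.symm.toHomeomorph.subtype
    (p := (· ∈ Metric.sphere (0 : EuclideanSpace ℝ (Fin 2)) 1))
    (q := (· ∈ Submonoid.unitSphere ℂ)) fun x => by
      rw [mem_sphere_zero_iff_norm]
      exact (Complex.orthonormalBasisOneI.repr.symm.norm_map x ▸ mem_sphere_zero_iff_norm.symm)).trans
    (AddCircle.homeomorphCircle one_ne_zero).symm

theorem exists_lift_of_isOpenEmbedding {N M V : Type*} [TopologicalSpace N] [TopologicalSpace M]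
    [TopologicalSpace V] (p : C(N, M)) {φ : V → M} (hφ : IsOpenEmbedding φ) :
    ∃ l : C(p ⁻¹' Set.range φ, V), ∀ x, φ (l x) = p x := by
  let e := hφ.isEmbedding.toHomeomorph
  refine ⟨(e.symm : C(Set.range φ, V)).comp ⟨fun x => ⟨p x, x.2⟩, by fun_prop⟩, fun x => ?_⟩
  exact congrArg Subtype.val (e.apply_symm_apply ⟨p x, x.2⟩)

/-- Consider two maps from a space covered by two open sets to path-connected spaces without second
homotopy such that each of the maps factors through a simply connected space on one of these sets.
Then for every torus in that space one of the maps kills the image of its fundamental class. -/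
theorem exists_Hmap_comp_eq_zero {N : Type} [TopologicalSpace N] {B : Bool → TopCat.{0}}
    (hB : ∀ i, PathConnectedSpace (B i)) (hB₂ : ∀ i, Pi2Trivial (B i)) (q : ∀ i, C(N, B i))
    {U : Bool → Set N} (hU : ∀ i, IsOpen (U i)) (hcov : ∀ x, ∃ i, x ∈ U i)
    {V : Type*} [TopologicalSpace V] [SimplyConnectedSpace V] (l : ∀ i, C(U i, V))
    (κ : ∀ i, C(V, B i)) (h : ∀ i (x : U i), q i x = κ i (l i x))
    (f : C(Torus2, N)) {ω : H 2 Torus2} (hω : IsGenerator ω) :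
    ∃ i, Hmap 2 ((q i).comp f) ω = 0 := by
  let e := unitSphereHomeomorphUnitAddCircle
  let e₂ : C(Torus2, UnitAddCircle × UnitAddCircle) :=
    (e : C(unitSphere 1, UnitAddCircle)).prodMap e
  let e₂' : C(UnitAddCircle × UnitAddCircle, Torus2) :=
    (e.symm : C(UnitAddCircle, unitSphere 1)).prodMap e.symm
  obtain ⟨i, γ, h₁, h₂⟩ := UnitAddCircle.exists_map_torusLoop_mem_zpowers q hU hcov l κ h
    (f.comp e₂')
  obtain ⟨k, m, hkm⟩ := UnitAddCircle.exists_homotopic_comp_of_mem_zpowers (hB₂ i) _ γ h₁ h₂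
  have hf : (q i).comp f = ((q i).comp (f.comp e₂')).comp e₂ := by
    ext x
    simp [e₂, e₂', Prod.map]
  have hs : ((k.comp m).comp e₂ : C(Torus2, B i)) =
      (k.comp (e : C(unitSphere 1, UnitAddCircle))).comp ((e.symm : C(UnitAddCircle, unitSphere 1)).comp (m.comp e₂)) := by
    ext x
    simp
  have := subsingleton_H_of_isGenerator_prod two_ne_zero (e.symm 0) hω
  refine ⟨i, ?_⟩
  rw [hf, Hmap_eq_of_homotopic 2 (hkm.comp (.refl _)), hs, Hmap_comp, LinearMap.comp_apply,
    Subsingleton.elim (Hmap 2 _ ω) 0, map_zero]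

/-- **Theorem.**  Let `M₁, M₂` be closed oriented `n`-manifolds, `n ≥ 4`, with
`π₂(Mⱼ) = 0`, and let `vⱼ ∈ H₂(Mⱼ; ℚ)` be non-trivial classes not killed by the
classifying maps.  Then the class `v = (v₁, v₂)` of `H₂(M₁ # M₂; ℚ) ≅ H₂(M₁; ℚ) ⊕
H₂(M₂; ℚ)` (the identification being induced by the degree-one pinch maps) is
atoroidal. -/
theorem connectedSum_class_atoroidal
    (n : ℕ) (hn : 4 ≤ n) (M₁ M₂ : Type)
    [TopologicalSpace M₁] [TopologicalSpace M₂]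
    (hM₁ : IsClosedOrientedManifold n M₁) (hM₂ : IsClosedOrientedManifold n M₂)
    (hπ₁ : Pi2Trivial M₁) (hπ₂ : Pi2Trivial M₂)
    (B₁ : TopCat.{0}) (c₁ : C(M₁, B₁)) (hc₁ : IsClassifyingMap c₁)
    (B₂ : TopCat.{0}) (c₂ : C(M₂, B₂)) (hc₂ : IsClassifyingMap c₂)
    (v₁ : H 2 M₁) (v₂ : H 2 M₂) (hv₁ : v₁ ≠ 0) (hv₂ : v₂ ≠ 0)
    (hcv₁ : Hmap 2 c₁ v₁ ≠ 0) (hcv₂ : Hmap 2 c₂ v₂ ≠ 0)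
    (N : Type) [TopologicalSpace N] (D : ConnectedSumData n N M₁ M₂)
    (p₁ : C(N, M₁)) (p₂ : C(N, M₂))
    (hp₁ : D.IsPinchFst p₁) (hp₂ : D.IsPinchSnd p₂)
    (v : H 2 N) (hvp₁ : Hmap 2 p₁ v = v₁) (hvp₂ : Hmap 2 p₂ v = v₂)
    (ωT : H 2 Torus2) (hωT : IsGenerator ωT) :
    IsAtoroidal ωT v := by
  have hα {α : ℚ} (hα : α ≠ 0) : Hmap 2 (c₁.comp p₁) (α • v) ≠ 0 ∧
      Hmap 2 (c₂.comp p₂) (α • v) ≠ 0 := by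
    simp only [Hmap_comp, LinearMap.comp_apply, map_smul, hvp₁, hvp₂]
    exact ⟨smul_ne_zero hα hcv₁, smul_ne_zero hα hcv₂⟩
  refine ⟨?_, fun ⟨f, α, hα0, hf⟩ => ?_⟩
  · rintro rfl
    exact hv₁ (by rw [← hvp₁, map_zero])
  obtain ⟨l₁, hl₁⟩ := exists_lift_of_isOpenEmbedding p₁ D.emb₁
  obtain ⟨l₂, hl₂⟩ := exists_lift_of_isOpenEmbedding p₂ D.emb₂
  let φ₁ : C(EuclideanSpace ℝ (Fin n), M₁) := ⟨D.φ₁, D.emb₁.continuous⟩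
  let φ₂ : C(EuclideanSpace ℝ (Fin n), M₂) := ⟨D.φ₂, D.emb₂.continuous⟩
  obtain ⟨i, hi⟩ := exists_Hmap_comp_eq_zero (B := Bool.rec B₂ B₁)
    (q := Bool.rec (c₂.comp p₂) (c₁.comp p₁))
    (U := Bool.rec (p₂ ⁻¹' Set.range D.φ₂) (p₁ ⁻¹' Set.range D.φ₁))
    (Bool.rec hc₂.1.1 hc₁.1.1)
    (Bool.rec (hc₂.1.2 2 le_rfl) (hc₁.1.2 2 le_rfl))
    (Bool.rec (D.emb₂.isOpen_range.preimage p₂.continuous)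
      (D.emb₁.isOpen_range.preimage p₁.continuous))
    (fun x => (D.cover ▸ Set.mem_univ x : x ∈ D.C₁ ∪ D.C₂).elim
      (fun hx => ⟨false, Set.image_subset_range _ _ (hp₂.2 ⟨x, hx⟩)⟩)
      (fun hx => ⟨true, Set.image_subset_range _ _ (hp₁.2 ⟨x, hx⟩)⟩))
    (Bool.rec l₂ l₁) (Bool.rec (c₂.comp φ₂) (c₁.comp φ₁))
    (Bool.rec (fun x => congrArg c₂ (hl₂ x).symm) (fun x => congrArg c₁ (hl₁ x).symm)) f hωT
  rw [Hmap_comp, LinearMap.comp_apply, hf] at hi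
  cases i
  · exact (hα hα0).2 hi
  · exact (hα hα0).1 hi

end
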